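/- arXiv:math/0610242 — 2 statements merged into one kernel-verified Lean document; each statement's English description precedes it below -/
import Mathlib

section
/- Under hypotheses (H0)-(H4), for every a = (α,β) ∈ (Θ×ℝ)∩∂₊D, the constant positive multiples of h_a are the only nonnegative harmonic functions h of the Markov chain (Z(t)) satisfying sup_{x∈ℤ^{d−1}} exp(−α·x)·h(x,y) < ∞ for every y ∈ ℕ. -/
open scoped ENNReal
open Filter MeasureTheory

namespace ReflectedRW

/-- `ℤ^d` realized as `ℤ^{d-1} × ℤ`. -/
abbrev Zd (d : ℕ) := (Fin (d-1) → ℤ) × ℤ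
/-- `ℝ^d` realized as `ℝ^{d-1} × ℝ`. -/
abbrev Rd (d : ℕ) := (Fin (d-1) → ℝ) × ℝ
/-- The state space `ℤ^{d-1} × ℕ` of the reflected walk. -/
abbrev St (d : ℕ) := (Fin (d-1) → ℤ) × ℕ

/-- Embedding of the state space into `ℤ^d`. -/
def toZ (d : ℕ) (z : St d) : Zd d := (z.1, (z.2 : ℤ))

/-- Embedding of `ℤ^d` into `ℝ^d`. -/
def toR (d : ℕ) (z : Zd d) : Rd d := (fun i => (z.1 i : ℝ), (z.2 : ℝ))

/-- Scalar product `a · z` of `a ∈ ℝ^d` and `z ∈ ℤ^d`. -/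
noncomputable def dotZ (d : ℕ) (a : Rd d) (z : Zd d) : ℝ :=
  (∑ i, a.1 i * (z.1 i : ℝ)) + a.2 * (z.2 : ℝ)

/-- Scalar product on `ℝ^d`. -/
noncomputable def dotR (d : ℕ) (a q : Rd d) : ℝ :=
  (∑ i, a.1 i * q.1 i) + a.2 * q.2

/-- One-step transition probabilities of the reflected random walk `Z(t)`:
jumps with law `μ` in the interior and with law `μ0` on the boundary `y = 0`. -/
noncomputable def step (d : ℕ) (μ μ0 : Zd d → ℝ) (z z' : St d) : ℝ≥0∞ :=
  if z.2 = 0 then ENNReal.ofReal (μ0 (toZ d z' - toZ d z))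
  else ENNReal.ofReal (μ (toZ d z' - toZ d z))

/-- Real-valued version of the transition kernel of `Z(t)`. -/
noncomputable def stepR (d : ℕ) (μ μ0 : Zd d → ℝ) (z z' : St d) : ℝ :=
  if z.2 = 0 then μ0 (toZ d z' - toZ d z) else μ (toZ d z' - toZ d z)

/-- `n`-step kernel obtained by iterating a sub-Markov kernel `p`. -/
noncomputable def kerIter {S : Type*} [DecidableEq S] (p : S → S → ℝ≥0∞) :
    ℕ → S → S → ℝ≥0∞
  | 0, z, z' => if z = z' then 1 else 0
  | n+1, z, z' => ∑' w : S, kerIter p n z w * p w z'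

/-- `n`-step transition probabilities of `Z(t)`: `P_z(Z(n) = z')`. -/
noncomputable def stepn (d : ℕ) (μ μ0 : Zd d → ℝ) : ℕ → St d → St d → ℝ≥0∞ :=
  kerIter (step d μ μ0)

/-- Green's function `G(z,z') = ∑_{t ≥ 0} P_z(Z(t) = z')` of the reflected walk. -/
noncomputable def green (d : ℕ) (μ μ0 : Zd d → ℝ) (z z' : St d) : ℝ≥0∞ :=
  ∑' n : ℕ, stepn d μ μ0 n z z'

/-- Kernel of the walk killed upon hitting the boundary hyperplane `y = 0`. -/
noncomputable def stepKilled (d : ℕ) (μ μ0 : Zd d → ℝ) (z z' : St d) : ℝ≥0∞ :=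
  if z'.2 = 0 then 0 else step d μ μ0 z z'

/-- `n`-step kernel of the killed walk: `P_z(Z(n) = z', τ > n)` where
`τ` is the first return time to the boundary hyperplane. -/
noncomputable def stepKilledn (d : ℕ) (μ μ0 : Zd d → ℝ) : ℕ → St d → St d → ℝ≥0∞ :=
  kerIter (stepKilled d μ μ0)

/-- Green's function `G₊(z,z')` of the killed walk. -/
noncomputable def greenPlus (d : ℕ) (μ μ0 : Zd d → ℝ) (z z' : St d) : ℝ≥0∞ :=
  ∑' n : ℕ, stepKilledn d μ μ0 n z z'

/-- One-step kernel of the homogeneous random walk `S(t)` on `ℤ^d`. -/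
noncomputable def stepS (d : ℕ) (μ : Zd d → ℝ) (z z' : Zd d) : ℝ≥0∞ :=
  ENNReal.ofReal (μ (z' - z))

/-- `n`-step kernel of the homogeneous random walk on `ℤ^d`. -/
noncomputable def stepSn (d : ℕ) (μ : Zd d → ℝ) : ℕ → Zd d → Zd d → ℝ≥0∞ :=
  kerIter (stepS d μ)

/-- Green's function `G_S` of the homogeneous random walk on `ℤ^d`. -/
noncomputable def greenS (d : ℕ) (μ : Zd d → ℝ) (z z' : Zd d) : ℝ≥0∞ :=
  ∑' n : ℕ, stepSn d μ n z z'

/-- `hitProb z w = P_z(τ < ∞, Z(τ) = w)`, the hitting distribution on the boundary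
hyperplane, `τ = inf{t ≥ 1 : Z(t) ∈ ℤ^{d-1}×{0}}`. -/
noncomputable def hitProb (d : ℕ) (μ μ0 : Zd d → ℝ) (z w : St d) : ℝ≥0∞ :=
  if w.2 = 0 then
    ∑' n : ℕ, ∑' v : St d, stepKilledn d μ μ0 n z v * step d μ μ0 v w
  else 0

/-- The jump generating function `φ(a) = ∑_z μ(z) e^{a·z}`. -/
noncomputable def jgf (d : ℕ) (μ : Zd d → ℝ) (a : Rd d) : ℝ :=
  ∑' z : Zd d, μ z * Real.exp (dotZ d a z)

/-- Partial derivative `∂φ/∂β` of the jump generating function in the last coordinate. -/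
noncomputable def jgfDβ (d : ℕ) (μ : Zd d → ℝ) (a : Rd d) : ℝ :=
  ∑' z : Zd d, μ z * (z.2 : ℝ) * Real.exp (dotZ d a z)

/-- Gradient `∇φ(a)` of the jump generating function. -/
noncomputable def jgfGrad (d : ℕ) (μ : Zd d → ℝ) (a : Rd d) : Rd d :=
  (fun i => ∑' z : Zd d, μ z * (z.1 i : ℝ) * Real.exp (dotZ d a z), jgfDβ d μ a)

/-- The set `D = {a : φ(a) ≤ 1}`. -/
def Dset (d : ℕ) (μ : Zd d → ℝ) : Set (Rd d) := {a | jgf d μ a ≤ 1}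

/-- `∂₊D`: points of the boundary of `D` where the last coordinate of `∇φ` is `≥ 0`. -/
def bdPlus (d : ℕ) (μ : Zd d → ℝ) : Set (Rd d) :=
  {a | jgf d μ a = 1 ∧ 0 ≤ jgfDβ d μ a}

/-- `∂₋D`: points of the boundary of `D` where the last coordinate of `∇φ` is `≤ 0`. -/
def bdMinus (d : ℕ) (μ : Zd d → ℝ) : Set (Rd d) :=
  {a | jgf d μ a = 1 ∧ jgfDβ d μ a ≤ 0}

/-- `∂₀D`: points of the boundary of `D` where the last coordinate of `∇φ` is `0`. -/
def bdZero (d : ℕ) (μ : Zd d → ℝ) : Set (Rd d) :=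
  {a | jgf d μ a = 1 ∧ jgfDβ d μ a = 0}

/-- `Θ = {α ∈ ℝ^{d-1} : inf_β max(φ(α,β), φ₀(α,β)) ≤ 1}`. -/
noncomputable def Theta (d : ℕ) (μ μ0 : Zd d → ℝ) : Set (Fin (d-1) → ℝ) :=
  {α | (⨅ β : ℝ, max (jgf d μ (α, β)) (jgf d μ0 (α, β))) ≤ 1}

/-- `D̂ = (Θ×ℝ) ∩ D`. -/
noncomputable def Dhat (d : ℕ) (μ μ0 : Zd d → ℝ) : Set (Rd d) :=
  {a | a.1 ∈ Theta d μ μ0 ∧ jgf d μ a ≤ 1}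

/-- Normal cone to a convex set `s ⊆ ℝ^d` at the point `a`. -/
noncomputable def normalCone (d : ℕ) (s : Set (Rd d)) (a : Rd d) : Set (Rd d) :=
  {q | ∀ b ∈ s, dotR d q (b - a) ≤ 0}

/-- The mean vector `m = ∑_z z μ(z)`. -/
noncomputable def meanVec (d : ℕ) (μ : Zd d → ℝ) : Rd d :=
  (fun i => ∑' z : Zd d, μ z * (z.1 i : ℝ), ∑' z : Zd d, μ z * (z.2 : ℝ))

/-- The harmonic functions `h_a` of (1-8), for `a ∈ D̂ ∩ ∂₊D` with associated
point `abar = ā ∈ ∂₋D` (same first `d-1` coordinates as `a`). -/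
noncomputable def hfun (d : ℕ) (μ μ0 : Zd d → ℝ) (a abar : Rd d) (z : St d) : ℝ :=
  if jgf d μ0 abar = 1 then Real.exp (dotZ d abar (toZ d z))
  else if a = abar then
    (z.2 : ℝ) * Real.exp (dotZ d a (toZ d z))
      + (jgfDβ d μ0 a / (1 - jgf d μ0 a)) * Real.exp (dotZ d a (toZ d z))
  else
    Real.exp (dotZ d a (toZ d z))
      - ((1 - jgf d μ0 a) / (1 - jgf d μ0 abar)) * Real.exp (dotZ d abar (toZ d z))

/-- `h : ℤ^{d-1}×ℕ → ℝ` is harmonic for the reflected walk. -/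
def IsHarmonic (d : ℕ) (μ μ0 : Zd d → ℝ) (h : St d → ℝ) : Prop :=
  ∀ z : St d, HasSum (fun z' => stepR d μ μ0 z z' * h z') (h z)

/-- Minimal nonnegative harmonic function. -/
def IsMinimalHarmonic (d : ℕ) (μ μ0 : Zd d → ℝ) (h : St d → ℝ) : Prop :=
  IsHarmonic d μ μ0 h ∧ (∀ z, 0 ≤ h z) ∧ h ≠ 0 ∧
    ∀ h' : St d → ℝ, IsHarmonic d μ μ0 h' → (∀ z, 0 ≤ h' z) → h' ≠ 0 →
      (∀ z, h' z ≤ h z) → ∃ c : ℝ, 0 < c ∧ h' = fun z => c * h z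

/- Hypotheses (H0)–(H4). -/

/-- `(H0)`: `μ(x,y) = 0` for `y < -1` and `μ₀(x,y) = 0` for `y < 0`. -/
def H0 (d : ℕ) (μ μ0 : Zd d → ℝ) : Prop :=
  (∀ z : Zd d, z.2 < -1 → μ z = 0) ∧ (∀ z : Zd d, z.2 < 0 → μ0 z = 0)

/-- `(H1)`: the reflected walk is irreducible on `ℤ^{d-1}×ℕ`. -/
def H1 (d : ℕ) (μ μ0 : Zd d → ℝ) : Prop :=
  ∀ z z' : St d, ∃ n : ℕ, 0 < stepn d μ μ0 n z z'

/-- `(H2)`: the homogeneous walk with step law `μ` is irreducible on `ℤ^d` and its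
last coordinate is an aperiodic random walk on `ℤ`. -/
def H2 (d : ℕ) (μ : Zd d → ℝ) : Prop :=
  (∀ z z' : Zd d, ∃ n : ℕ, 0 < stepSn d μ n z z') ∧
    AddSubgroup.closure {y : ℤ | ∃ x : Fin (d-1) → ℤ, μ (x, y) ≠ 0} = ⊤

/-- `(H3)`: `m ≠ 0` and `m/|m| + m₀/|m₀| ≠ 0`. -/
noncomputable def H3 (d : ℕ) (μ μ0 : Zd d → ℝ) : Prop :=
  meanVec d μ ≠ 0 ∧ meanVec d μ0 ≠ 0 ∧
    ‖meanVec d μ‖⁻¹ • meanVec d μ + ‖meanVec d μ0‖⁻¹ • meanVec d μ0 ≠ 0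

/-- `(H4)`: the jump generating functions are finite everywhere on `ℝ^d`. -/
def H4 (d : ℕ) (μ μ0 : Zd d → ℝ) : Prop :=
  ∀ a : Rd d, Summable (fun z : Zd d => μ z * Real.exp (dotZ d a z)) ∧
    Summable (fun z : Zd d => μ0 z * Real.exp (dotZ d a z))

/-- `μ` is a probability distribution on `ℤ^d`. -/
def IsProb (d : ℕ) (μ : Zd d → ℝ) : Prop :=
  (∀ z : Zd d, 0 ≤ μ z) ∧ HasSum μ 1

theorem second_difference_nonneg {ι : Type*} (S : Module.End ℝ (ι → ℝ)) (K : Set (ι → ℝ))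
    {M : ℝ} (hM : 0 < M) (hpos : ∀ f ∈ K, ∀ i, 0 ≤ f i) (hS : ∀ f ∈ K, M⁻¹ • S f ∈ K)
    (hS' : ∀ f ∈ K, f - M⁻¹ • S f ∈ K) {f : ι → ℝ} (hf : f ∈ K) (i : ι) :
    0 ≤ S (S f) i - 2 * S f i + f i := by
  set P : Module.End ℝ (ι → ℝ) := M⁻¹ • S with hP
  have hpow : ∀ k : ℕ, ∀ g ∈ K, (P ^ k) g ∈ K := by
    intro k
    induction k with
    | zero => intro g hg; simpa using hg
    | succ k ih => intro g hg; rw [pow_succ]; exact ih _ (hS g hg)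
  have hpow' : ∀ k : ℕ, ∀ g ∈ K, ((1 - P) ^ k) g ∈ K := by
    intro k
    induction k with
    | zero => intro g hg; simpa using hg
    | succ k ih => intro g hg; rw [pow_succ]; exact ih _ (hS' g hg)
  let L : Polynomial ℝ →ₗ[ℝ] ℝ :=
    { toFun := fun q => (Polynomial.aeval P q) f i
      map_add' := by intro p q; simp
      map_smul' := by intro c p; simp }
  have hL : ∀ q, L q = (Polynomial.aeval P q) f i := fun q => rfl
  have hb : ∀ n k, 0 ≤ L (bernsteinPolynomial ℝ n k) := by
    intro n k
    rw [hL, bernsteinPolynomial]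
    have h1 : Polynomial.aeval P ((n.choose k : Polynomial ℝ) * Polynomial.X ^ k *
        (1 - Polynomial.X) ^ (n - k)) = (n.choose k : ℝ) • (P ^ k * (1 - P) ^ (n - k)) := by
      simp [mul_assoc, Algebra.smul_def]
    rw [h1]
    have h2 := hpos _ (hpow k _ (hpow' (n - k) f hf)) i
    simpa using mul_nonneg (Nat.cast_nonneg _) h2
  have hX : M * L Polynomial.X = S f i := by
    simp [hL, hP, hM.ne']
  have hX2 : M ^ 2 * L (Polynomial.X ^ 2) = S (S f) i := by
    simp [hL, hP, pow_two]
    field_simp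
  have h1 : L 1 = f i := by simp [hL]
  have hLn : ∀ (m : ℕ) (q : Polynomial ℝ), L (m • q) = m * L q := fun m q => by
    rw [map_nsmul, nsmul_eq_mul]
  set T := S (S f) i - 2 * S f i + f i with hT
  have key : ∀ n : ℕ, -(M ^ 2 * f i) ≤ (n + 1) * T := by
    intro n
    have e0 : ∑ k ∈ Finset.range (n + 3), L (bernsteinPolynomial ℝ (n + 2) k) = L 1 := by
      rw [← map_sum, bernsteinPolynomial.sum ℝ (n + 2)]
    have e1 : ∑ k ∈ Finset.range (n + 3), (k : ℝ) * L (bernsteinPolynomial ℝ (n + 2) k)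
        = (n + 2) * L Polynomial.X := by
      have := congrArg L (bernsteinPolynomial.sum_smul ℝ (n + 2))
      simpa only [map_sum, hLn, Nat.cast_add, Nat.cast_ofNat] using this
    have e2 : ∑ k ∈ Finset.range (n + 3),
        ((k : ℝ) * ((k : ℝ) - 1)) * L (bernsteinPolynomial ℝ (n + 2) k)
        = (n + 2) * (n + 1) * L (Polynomial.X ^ 2) := by
      have := congrArg L (bernsteinPolynomial.sum_mul_smul ℝ (n + 2))
      simp only [map_sum, hLn] at this
      rw [Finset.sum_congr rfl (g := fun k : ℕ => ((k * (k - 1) : ℕ) : ℝ) *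
        L (bernsteinPolynomial ℝ (n + 2) k))]
      · rw [this]; push_cast; simp
      · intro k _
        cases k <;> simp
    have hle : ∑ k ∈ Finset.range (n + 3), (-(M ^ 2 * ((n : ℝ) + 2) ^ 2)) *
        L (bernsteinPolynomial ℝ (n + 2) k) ≤
        ∑ k ∈ Finset.range (n + 3), (M ^ 2 * ((k : ℝ) * ((k : ℝ) - 1)) * (n + 2)
          - 2 * M * k * (n + 2) * (n + 1) + (n + 2) ^ 2 * (n + 1)) *
        L (bernsteinPolynomial ℝ (n + 2) k) := by
      refine Finset.sum_le_sum fun k hk => mul_le_mul_of_nonneg_right ?_ (hb _ _)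
      have e : M ^ 2 * ((k : ℝ) * ((k : ℝ) - 1)) * (n + 2)
          - 2 * M * k * (n + 2) * (n + 1) + (n + 2) ^ 2 * (n + 1)
          = (n + 1) * (M * k - (n + 2)) ^ 2 + M ^ 2 * (k ^ 2 - k * (n + 2)) := by ring
      rw [e]
      have h3 : 0 ≤ ((n : ℝ) + 1) * (M * k - (n + 2)) ^ 2 := by positivity
      have h4 : 0 ≤ M ^ 2 * ((k : ℝ) ^ 2 - k * (n + 2) + (n + 2) ^ 2) := by
        refine mul_nonneg (sq_nonneg _) ?_
        nlinarith [sq_nonneg ((k : ℝ) - (n + 2) / 2), sq_nonneg ((n : ℝ) + 2)]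
      nlinarith
    have hsum : ∑ k ∈ Finset.range (n + 3), (M ^ 2 * ((k : ℝ) * ((k : ℝ) - 1)) * (n + 2)
          - 2 * M * k * (n + 2) * (n + 1) + (n + 2) ^ 2 * (n + 1)) *
        L (bernsteinPolynomial ℝ (n + 2) k) = (n + 2) ^ 2 * ((n + 1) * T) := by
      have : ∀ k : ℕ, (M ^ 2 * ((k : ℝ) * ((k : ℝ) - 1)) * (n + 2)
          - 2 * M * k * (n + 2) * (n + 1) + (n + 2) ^ 2 * (n + 1)) *
          L (bernsteinPolynomial ℝ (n + 2) k) =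
          M ^ 2 * (n + 2) * (((k : ℝ) * ((k : ℝ) - 1)) * L (bernsteinPolynomial ℝ (n + 2) k))
          - 2 * M * (n + 2) * (n + 1) * ((k : ℝ) * L (bernsteinPolynomial ℝ (n + 2) k))
          + (n + 2) ^ 2 * (n + 1) * L (bernsteinPolynomial ℝ (n + 2) k) := by intro k; ring
      simp_rw [this]
      rw [Finset.sum_add_distrib, Finset.sum_sub_distrib, ← Finset.mul_sum, ← Finset.mul_sum,
        ← Finset.mul_sum, e0, e1, e2, hT, ← hX, ← hX2, ← h1]
      ring
    rw [hsum, ← Finset.mul_sum, e0, h1] at hle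
    have hn : (0 : ℝ) < (n + 2) ^ 2 := by positivity
    refine le_of_mul_le_mul_left ?_ hn
    linarith
  by_contra hneg
  push Not at hneg
  obtain ⟨n, hn⟩ := exists_nat_gt (M ^ 2 * f i / -T)
  have := key n
  rw [div_lt_iff₀ (by linarith)] at hn
  nlinarith

theorem add_mul_sub_le_of_second_difference_nonneg {c : ℕ → ℝ}
    (hc : ∀ k, 0 ≤ c (k + 2) - 2 * c (k + 1) + c k) (k : ℕ) :
    c 0 + k * (c 1 - c 0) ≤ c k := by
  have hd : ∀ k, c 1 - c 0 ≤ c (k + 1) - c k := by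
    intro k
    induction k with
    | zero => simp
    | succ k ih => linarith [hc k]
  induction k with
  | zero => simp
  | succ k ih => push_cast; linarith [hd k]

theorem le_of_second_difference_nonneg_of_bounded {c : ℕ → ℝ}
    (hc : ∀ k, 0 ≤ c (k + 2) - 2 * c (k + 1) + c k) {B : ℝ} (hB : ∀ k, c k ≤ B) :
    c 1 ≤ c 0 := by
  by_contra! h
  obtain ⟨n, hn⟩ := exists_nat_gt ((B - c 0) / (c 1 - c 0))
  rw [div_lt_iff₀ (by linarith)] at hn
  linarith [add_mul_sub_le_of_second_difference_nonneg hc n, hB n]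

/-- Harmonicity for the upward walk on `ℕ` satisfied by the increments of a function that is
harmonic for a downward skip-free walk. -/
def IncrHarmonic (p : ℕ → ℝ) (E : ℕ → ℝ) : Prop :=
  ∀ y, HasSum (fun v => p (v + 1) * ∑ j ∈ Finset.range v, E (y + 1 + j)) (p 0 * E y)

theorem IncrHarmonic.shift {p E : ℕ → ℝ} (h : IncrHarmonic p E) :
    IncrHarmonic p (fun y => E (y + 1)) := by
  intro y
  refine (h (y + 1)).congr_fun ?_
  intro v
  simp only [add_right_comm _ 1]

theorem IncrHarmonic.sub_const_mul {p E G : ℕ → ℝ} (hE : IncrHarmonic p E) (hG : IncrHarmonic p G)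
    (c : ℝ) : IncrHarmonic p (fun y => E y - c * G y) := by
  intro y
  have := (hE y).sub ((hG y).mul_left c)
  convert! this using 1
  · funext v
    rw [Finset.sum_sub_distrib, ← Finset.mul_sum]
    ring
  · ring

theorem IncrHarmonic.const_mul {p E : ℕ → ℝ} (hE : IncrHarmonic p E)
    (c : ℝ) : IncrHarmonic p (fun y => c * E y) := by
  intro y
  have := ((hE y).mul_left c)
  convert! this using 1
  · funext v
    rw [← Finset.mul_sum]
    ring
  · ring

theorem incrHarmonic_of_harmonic {p F : ℕ → ℝ} (hp : HasSum p 1)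
    (hF : ∀ y, HasSum (fun k => p k * F (y + k)) (F (y + 1))) :
    IncrHarmonic p (fun y => F (y + 1) - F y) := by
  intro y
  have h1 : HasSum (fun k => p k * (F (y + k) - F (y + 1))) 0 := by
    have := (hF y).sub (hp.mul_right (F (y + 1)))
    simpa [mul_sub] using this
  rw [hasSum_nat_add_iff' 1 |>.symm] at h1
  simp only [Finset.range_one, Finset.sum_singleton, add_zero, zero_sub] at h1
  convert! h1 using 1
  · funext v
    congr 1
    have := Finset.sum_range_sub (fun j => F (y + 1 + j)) v
    simp only [add_zero, ← add_assoc] at this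
    rw [← add_assoc, add_right_comm y v 1, ← this]
  · ring

/-- The increments of a nonnegative function harmonic for a downward skip-free walk with
nonpositive drift are nonnegative. -/
theorem le_succ_of_harmonic {p F : ℕ → ℝ} {m : ℝ} (hp0 : ∀ k, 0 ≤ p k) (hp00 : 0 < p 0)
    (hp : HasSum p 1) (hm : HasSum (fun k => p k * k) m) (hm1 : m ≤ 1)
    (hF0 : ∀ y, 0 ≤ F y)
    (hF : ∀ y, HasSum (fun k => p k * F (y + k)) (F (y + 1))) (y : ℕ) : F y ≤ F (y + 1) := by
  have key : ∀ δ : ℝ, 0 < δ → F y * (1 - δ) ≤ F (y + 1) := by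
    intro δ hδ
    set w : ℕ → ℝ := fun k => F (y + k) - F y * (1 - δ * k) with hw
    have hw0 : w 0 = 0 := by simp [hw]
    obtain ⟨N, hN⟩ := exists_nat_gt (1 / δ)
    have hbig : ∀ k, N ≤ k → 0 ≤ w k := by
      intro k hk
      have h1 : 1 ≤ δ * k := by
        rw [div_lt_iff₀ hδ] at hN
        have : (N : ℝ) ≤ k := by exact_mod_cast hk
        nlinarith
      have := mul_nonneg (hF0 y) (sub_nonneg.2 h1)
      have := hF0 (y + k)
      simp only [hw]
      linarith
    have hsup : ∀ k, ∃ s, s ≤ w (k + 1) ∧ HasSum (fun j => p j * w (k + j)) s := by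
      intro k
      refine ⟨F (y + k + 1) - F y * (1 - δ * (k + m)), ?_, ?_⟩
      · simp only [hw]
        push_cast
        have h1 := mul_nonneg (mul_nonneg (hF0 y) hδ.le) (sub_nonneg.2 hm1)
        rw [← add_assoc]
        linarith
      · have h1 := (hF (y + k)).sub
          (((hp.mul_right (1 - δ * k)).sub (hm.mul_left δ)).mul_left (F y))
        convert! h1 using 1
        · funext j
          simp only [hw]
          push_cast
          rw [← add_assoc]
          ring
        · ring
    have hall : ∀ k, 0 ≤ w k := by
      by_contra! hneg
      obtain ⟨k0, hk0⟩ := hneg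
      have hk0N : k0 ∈ Finset.range (N + 1) := by
        rw [Finset.mem_range]
        by_contra! h
        linarith [hbig k0 (by omega)]
      obtain ⟨k1, hk1, hmin⟩ := Finset.exists_min_image (Finset.range (N + 1)) w ⟨k0, hk0N⟩
      have hneg1 : w k1 < 0 := lt_of_le_of_lt (hmin k0 hk0N) hk0
      have hglob : ∀ k, w k1 ≤ w k := by
        intro k
        by_cases hk : k ∈ Finset.range (N + 1)
        · exact hmin k hk
        · rw [Finset.mem_range] at hk
          linarith [hbig k (by omega)]
      have hdown : ∀ k, w k ≠ w k1 := by
        intro k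
        induction k with
        | zero => rw [hw0]; exact hneg1.ne'
        | succ k ih =>
          intro h
          obtain ⟨s, hs, hsum⟩ := hsup k
          have hlt : w k1 < w k := lt_of_le_of_ne (hglob k) (Ne.symm ih)
          have : 1 * w k1 < s := hasSum_lt (i := 0)
            (fun j => mul_le_mul_of_nonneg_left (hglob (k + j)) (hp0 j))
            (by simpa using mul_lt_mul_of_pos_left hlt hp00)
            (hp.mul_right (w k1)) hsum
          linarith
      exact hdown k1 rfl
    have := hall 1
    simp only [hw, Nat.cast_one, mul_one] at this
    linarith
  refine le_of_forall_pos_le_add fun ε hε => ?_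
  have h1 : 0 < F y + 1 := by linarith [hF0 y]
  have h2 := key (ε / (F y + 1)) (by positivity)
  have h3 : F y * (ε / (F y + 1)) ≤ ε := by
    rw [mul_div_assoc', div_le_iff₀ h1]
    nlinarith
  linarith

theorem IncrHarmonic.eq_geometric {p E : ℕ → ℝ} (hp0 : ∀ k, 0 ≤ p k) (hp00 : 0 < p 0)
    (hpu : ∃ k, 0 < p (k + 2)) (hE : IncrHarmonic p E) (hE0 : ∀ y, 0 ≤ E y) {r : ℝ}
    (hr : 0 < r) (hgeo : IncrHarmonic p (fun y => r ^ y)) (y : ℕ) : E y = E 0 * r ^ y := by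
  obtain ⟨n, hn⟩ := hpu
  let S : Module.End ℝ (ℕ → ℝ) :=
    { toFun := fun f y => r⁻¹ * f (y + 1)
      map_add' := by intro f g; funext y; simp [mul_add]
      map_smul' := by intro c f; funext y; simp; ring }
  have hSa : ∀ f y, S f y = r⁻¹ * f (y + 1) := fun _ _ => rfl
  set M : ℝ := p 0 / p (n + 2) / r with hMdef
  have hM : 0 < M := by positivity
  have conv : ∀ y, 0 ≤ S (S E) y - 2 * S E y + E y := by
    intro y
    refine second_difference_nonneg S {f | IncrHarmonic p f ∧ ∀ y, 0 ≤ f y} hM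
      (fun f hf => hf.2) ?_ ?_ ⟨hE, hE0⟩ y
    · rintro f ⟨hf, hf0⟩
      refine ⟨?_, fun y => ?_⟩
      · have := hf.shift.const_mul (M⁻¹ * r⁻¹)
        convert! this using 2
        simp [hSa, mul_assoc]
      · have := hf0 (y + 1)
        simp only [Pi.smul_apply, hSa, smul_eq_mul]
        positivity
    · rintro f ⟨hf, hf0⟩
      refine ⟨?_, fun y => ?_⟩
      · have := hf.sub_const_mul hf.shift (M⁻¹ * r⁻¹)
        convert! this using 2
        simp [hSa]
        ring
      · have h1 : p (n + 2) * f (y + 1) ≤ p 0 * f y := by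
          refine le_trans ?_ (le_hasSum (hf y) (n + 1) fun j _ =>
            mul_nonneg (hp0 _) (Finset.sum_nonneg fun _ _ => hf0 _))
          refine mul_le_mul_of_nonneg_left ?_ (hp0 _)
          rw [Finset.sum_range_succ']
          have := Finset.sum_nonneg (s := Finset.range n)
            (f := fun j => f (y + 1 + (j + 1))) fun _ _ => hf0 _
          simpa using this
        simp only [Pi.sub_apply, Pi.smul_apply, hSa, smul_eq_mul, hMdef]
        have : (p 0 / p (n + 2) / r)⁻¹ * (r⁻¹ * f (y + 1)) = p (n + 2) * f (y + 1) / p 0 := by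
          field_simp
        rw [this, sub_nonneg, div_le_iff₀ hp00]
        linarith
  set b : ℕ → ℝ := fun k => E k / r ^ k with hb
  have hEb : ∀ k, E k = b k * r ^ k := fun k => by simp only [hb]; field_simp
  have hconv : ∀ k, 0 ≤ b (k + 2) - 2 * b (k + 1) + b k := by
    intro k
    have h1 := conv k
    have h2 : S (S E) k - 2 * S E k + E k = (b (k + 2) - 2 * b (k + 1) + b k) * r ^ k := by
      simp only [hSa, hEb]
      field_simp
      ring
    rw [h2] at h1
    exact nonneg_of_mul_nonneg_left h1 (by positivity)
  have hdiff : ∀ y c, HasSum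
      (fun v => p (v + 1) * ∑ j ∈ Finset.range v, (b (y + 1 + j) - c) * r ^ (y + 1 + j))
      (p 0 * ((b y - c) * r ^ y)) := by
    intro y c
    have := hE.sub_const_mul hgeo c y
    simpa only [hEb, ← sub_mul] using this
  have hanti : ∀ y, b (y + 1) ≤ b y := by
    intro y
    by_contra! hlt
    have hgt : ∀ j, b y < b (y + 1 + j) := by
      intro j
      have h1 := add_mul_sub_le_of_second_difference_nonneg (c := fun k => b (y + k))
        (fun k => hconv (y + k)) (j + 1)
      simp only [add_zero] at h1
      have h2 : 0 < ((j + 1 : ℕ) : ℝ) * (b (y + 1) - b y) := by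
        have : 0 < b (y + 1) - b y := by linarith
        positivity
      rw [add_assoc, add_comm 1 j]
      linarith
    have h0 := hdiff y (b y)
    simp only [sub_self, zero_mul, mul_zero] at h0
    have : (0 : ℝ) < 0 := by
      refine hasSum_lt (i := n + 1) (f := fun _ => 0) (fun v => ?_) ?_ hasSum_zero h0
      · exact mul_nonneg (hp0 _) (Finset.sum_nonneg fun j _ =>
          mul_nonneg (sub_nonneg.2 (hgt j).le) (by positivity))
      · exact mul_pos hn (Finset.sum_pos (fun j _ =>
          mul_pos (sub_pos.2 (hgt j)) (by positivity)) ⟨0, by simp⟩)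
    exact lt_irrefl _ this
  have hmono : ∀ y, b y ≤ b (y + 1) := by
    intro y
    have h0 := hdiff y (b (y + 1))
    have h1 : p 0 * ((b y - b (y + 1)) * r ^ y) ≤ 0 := by
      refine hasSum_le (g := fun _ => 0) (fun v => ?_) h0 hasSum_zero
      refine mul_nonpos_of_nonneg_of_nonpos (hp0 _) (Finset.sum_nonpos fun j _ => ?_)
      refine mul_nonpos_of_nonpos_of_nonneg ?_ (by positivity)
      have := antitone_nat_of_succ_le hanti (show y + 1 ≤ y + 1 + j by omega)
      linarith
    by_contra! h
    have : 0 < p 0 * ((b y - b (y + 1)) * r ^ y) := by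
      have := sub_pos.2 h
      positivity
    linarith
  have hconst : ∀ y, b y = b 0 := by
    intro y
    induction y with
    | zero => rfl
    | succ y ih => rw [← ih]; exact le_antisymm (hanti y) (hmono y)
  rw [hEb y, hconst y, hEb 0]
  simp

/-- Nonnegative harmonic functions of a downward skip-free walk with nonpositive drift. -/
theorem exists_eq_add_of_harmonic {p F G : ℕ → ℝ} {m c r : ℝ} (hp0 : ∀ k, 0 ≤ p k)
    (hp00 : 0 < p 0) (hpu : ∃ k, 0 < p (k + 2))
    (hp : HasSum p 1) (hm : HasSum (fun k => p k * k) m) (hm1 : m ≤ 1)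
    (hF0 : ∀ y, 0 ≤ F y)
    (hF : ∀ y, HasSum (fun k => p k * F (y + k)) (F (y + 1)))
    (hG : ∀ y, HasSum (fun k => p k * G (y + k)) (G (y + 1)))
    (hc : 0 < c) (hr : 0 < r) (hGr : ∀ y, G (y + 1) - G y = c * r ^ y) :
    ∃ A B : ℝ, 0 ≤ A ∧ ∀ y, F y = A * G y + B := by
  have hgeo : IncrHarmonic p (fun y => r ^ y) := by
    have := (incrHarmonic_of_harmonic hp hG).const_mul c⁻¹
    simp only [hGr] at this
    simpa [hc.ne'] using this
  have hmono := le_succ_of_harmonic hp0 hp00 hp hm hm1 hF0 hF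
  have hE := (incrHarmonic_of_harmonic hp hF).eq_geometric hp0 hp00 hpu
    (fun y => sub_nonneg.2 (hmono y)) hr hgeo
  simp only [zero_add] at hE
  set A := (F 1 - F 0) / c with hA
  have hA0 : 0 ≤ A := div_nonneg (sub_nonneg.2 (hmono 0)) hc.le
  refine ⟨A, F 0 - A * G 0, hA0, fun y => ?_⟩
  induction y with
  | zero => ring
  | succ y ih =>
    have h1 := hE y
    have h2 := hGr y
    have h3 : F 1 - F 0 = A * c := by rw [hA]; field_simp
    rw [h3] at h1
    have : A * (G (y + 1) - G y) = A * c * r ^ y := by rw [h2]; ring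
    linarith

/-- The Harnack inequality `ε * h z' ≤ h z`, uniformly over nonnegative harmonic functions. -/
def HarnackLE (d : ℕ) (μ μ0 : Zd d → ℝ) (z z' : St d) : Prop :=
  ∃ ε : ℝ, 0 < ε ∧ ∀ h : St d → ℝ, IsHarmonic d μ μ0 h → (∀ z, 0 ≤ h z) → ε * h z' ≤ h z

theorem kerIter_ne_zero_succ {S : Type*} [DecidableEq S] {p : S → S → ℝ≥0∞} {n : ℕ} {z z' : S}
    (h : kerIter p (n + 1) z z' ≠ 0) : ∃ w, kerIter p n z w ≠ 0 ∧ p w z' ≠ 0 := by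
  by_contra! hw
  refine h ?_
  rw [kerIter, ENNReal.tsum_eq_zero]
  intro w
  by_cases h0 : kerIter p n z w = 0
  · simp [h0]
  · simp [hw w h0]

theorem eq_of_kerIter_zero_ne_zero {S : Type*} [DecidableEq S] {p : S → S → ℝ≥0∞} {z z' : S}
    (h : kerIter p 0 z z' ≠ 0) : z = z' := by
  by_contra hne
  exact h (by simp [kerIter, hne])

theorem kerIter_invariant {S : Type*} [DecidableEq S] {p : S → S → ℝ≥0∞} {P : S → Prop}
    (hP : ∀ w w', p w w' ≠ 0 → P w → P w') {n : ℕ} {z z' : S} (h : kerIter p n z z' ≠ 0)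
    (hz : P z) : P z' := by
  induction n generalizing z' with
  | zero => exact eq_of_kerIter_zero_ne_zero h ▸ hz
  | succ n ih =>
    obtain ⟨w, hw, hw'⟩ := kerIter_ne_zero_succ h
    exact hP _ _ hw' (ih hw)

theorem stepR_nonneg {d : ℕ} {μ μ0 : Zd d → ℝ} (hμ : ∀ w, 0 ≤ μ w) (hμ0 : ∀ w, 0 ≤ μ0 w)
    (z z' : St d) : 0 ≤ stepR d μ μ0 z z' := by
  unfold stepR
  split_ifs
  exacts [hμ0 _, hμ _]

theorem IsHarmonic.stepR_mul_le {d : ℕ} {μ μ0 : Zd d → ℝ} (hμ : ∀ w, 0 ≤ μ w)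
    (hμ0 : ∀ w, 0 ≤ μ0 w) {h : St d → ℝ} (hh : IsHarmonic d μ μ0 h) (h0 : ∀ z, 0 ≤ h z)
    (z z' : St d) : stepR d μ μ0 z z' * h z' ≤ h z :=
  le_hasSum (hh z) z' fun w _ => mul_nonneg (stepR_nonneg hμ hμ0 _ _) (h0 w)

theorem HarnackLE.of_stepn_ne_zero {d : ℕ} {μ μ0 : Zd d → ℝ} (hμ : ∀ w, 0 ≤ μ w)
    (hμ0 : ∀ w, 0 ≤ μ0 w) {n : ℕ} {z z' : St d} (h : stepn d μ μ0 n z z' ≠ 0) :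
    HarnackLE d μ μ0 z z' := by
  unfold stepn at h
  induction n generalizing z' with
  | zero =>
    obtain rfl := eq_of_kerIter_zero_ne_zero h
    exact ⟨1, one_pos, fun h _ _ => by simp⟩
  | succ n ih =>
    obtain ⟨w, hw, hw'⟩ := kerIter_ne_zero_succ h
    obtain ⟨ε, hε, H⟩ := ih hw
    have hpos : 0 < stepR d μ μ0 w z' := by
      unfold step at hw'
      unfold stepR
      split_ifs at hw' ⊢ <;> simpa using hw'
    refine ⟨ε * stepR d μ μ0 w z', by positivity, fun h hh h0 => ?_⟩
    rw [mul_assoc]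
    exact (mul_le_mul_of_nonneg_left (hh.stepR_mul_le hμ hμ0 h0 w z') hε.le).trans (H h hh h0)

theorem harnack_interior {d : ℕ} {μ μ0 : Zd d → ℝ} (hμ : ∀ w, 0 ≤ μ w)
    (hμ0 : ∀ w, 0 ≤ μ0 w) (hH0 : H0 d μ μ0) {n : ℕ} {w : Zd d} (hw : stepSn d μ n 0 w ≠ 0) :
    -(n : ℤ) ≤ w.2 ∧ ∃ ε : ℝ, 0 < ε ∧ ∀ h : St d → ℝ, IsHarmonic d μ μ0 h → (∀ z, 0 ≤ h z) →
      ∀ z z' : St d, n ≤ z.2 → toZ d z' = toZ d z + w → ε * h z' ≤ h z := by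
  unfold stepSn at hw
  induction n generalizing w with
  | zero =>
    obtain rfl := eq_of_kerIter_zero_ne_zero hw
    refine ⟨by simp, 1, one_pos, fun h _ _ z z' _ hz => ?_⟩
    have : z' = z := by
      simp only [toZ, add_zero, Prod.mk.injEq, Nat.cast_inj] at hz
      exact Prod.ext hz.1 hz.2
    simp [this]
  | succ n ih =>
    obtain ⟨v, hv, hv'⟩ := kerIter_ne_zero_succ hw
    obtain ⟨hvn, ε, hε, H⟩ := ih hv
    have hpos : 0 < μ (w - v) := by simpa [stepS] using hv'
    have hdown : -1 ≤ (w - v).2 := by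
      by_contra! hlt
      exact hpos.ne' (hH0.1 _ hlt)
    rw [Prod.snd_sub] at hdown
    refine ⟨by push_cast; omega, ε * μ (w - v), by positivity, fun h hh h0 z z' hn hz => ?_⟩
    set u : St d := (z.1 + v.1, ((z.2 : ℤ) + v.2).toNat) with hu
    have hu2 : (u.2 : ℤ) = z.2 + v.2 := by simp only [hu]; omega
    have hzu : toZ d u = toZ d z + v := Prod.ext rfl hu2
    have hu0 : u.2 ≠ 0 := by omega
    have h1 := hh.stepR_mul_le hμ hμ0 h0 u z'
    have h2 : stepR d μ μ0 u z' = μ (w - v) := by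
      rw [stepR, if_neg hu0, hz, hzu]
      congr 1
      abel
    rw [h2] at h1
    rw [mul_assoc]
    exact (mul_le_mul_of_nonneg_left h1 hε.le).trans (H h hh h0 z u (by omega) hzu)

theorem IsHarmonic.translate {d : ℕ} {μ μ0 : Zd d → ℝ} {h : St d → ℝ}
    (hh : IsHarmonic d μ μ0 h) (x : Fin (d - 1) → ℤ) :
    IsHarmonic d μ μ0 fun z => h (z.1 + x, z.2) := by
  intro z
  have h1 := hh (z.1 + x, z.2)
  rw [← ((Equiv.addRight x).prodCongr (Equiv.refl ℕ)).hasSum_iff] at h1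
  convert! h1 using 1
  funext z'
  have : toZ d (z'.1 + x, z'.2) - toZ d (z.1 + x, z.2) = toZ d z' - toZ d z := by
    simp [toZ]
  change _ = stepR d μ μ0 (z.1 + x, z.2) (z'.1 + x, z'.2) * h (z'.1 + x, z'.2)
  simp only [stepR, this]

theorem exists_harnack_translate {d : ℕ} {μ μ0 : Zd d → ℝ} (hμ : ∀ w, 0 ≤ μ w)
    (hμ0 : ∀ w, 0 ≤ μ0 w) (hH0 : H0 d μ μ0) (hH1 : H1 d μ μ0) (hH2 : H2 d μ)
    (e : Fin (d - 1) → ℤ) :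
    ∃ M : ℝ, 0 < M ∧ ∀ h : St d → ℝ, IsHarmonic d μ μ0 h → (∀ z, 0 ≤ h z) →
      ∀ z : St d, h (z.1 + e, z.2) ≤ M * h z := by
  obtain ⟨n, hn⟩ := hH2.1 0 (e, 0)
  obtain ⟨-, ε, hε, H⟩ := harnack_interior hμ hμ0 hH0 hn.ne'
  have hlow : ∀ y : ℕ, HarnackLE d μ μ0 (0, y) (e, y) := fun y =>
    let ⟨_, hk⟩ := hH1 (0, y) (e, y)
    HarnackLE.of_stepn_ne_zero hμ hμ0 hk.ne'
  choose η hη Hη using hlow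
  refine ⟨ε⁻¹ + ∑ y ∈ Finset.range n, (η y)⁻¹, add_pos_of_pos_of_nonneg (by positivity)
    (Finset.sum_nonneg fun y _ => (inv_pos.2 (hη y)).le), fun h hh h0 z => ?_⟩
  have hs : 0 ≤ ∑ y ∈ Finset.range n, (η y)⁻¹ :=
    Finset.sum_nonneg fun y _ => (inv_pos.2 (hη y)).le
  rcases le_or_gt n z.2 with hz | hz
  · have h1 := H h hh h0 z (z.1 + e, z.2) hz (by simp [toZ])
    rw [← le_inv_mul_iff₀ hε] at h1
    nlinarith [h0 z]
  · have h1 := Hη z.2 _ (hh.translate z.1) fun _ => h0 _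
    simp only [zero_add] at h1
    rw [← le_inv_mul_iff₀ (hη _), add_comm e] at h1
    have h2 : (η z.2)⁻¹ ≤ ∑ y ∈ Finset.range n, (η y)⁻¹ :=
      Finset.single_le_sum (f := fun y => (η y)⁻¹) (fun y _ => (inv_pos.2 (hη y)).le)
        (Finset.mem_range.2 hz)
    have h3 : 0 < ε⁻¹ := inv_pos.2 hε
    refine h1.trans (mul_le_mul_of_nonneg_right (by linarith) (h0 z))

theorem IsHarmonic.sub_const_mul {d : ℕ} {μ μ0 : Zd d → ℝ} {f g : St d → ℝ}
    (hf : IsHarmonic d μ μ0 f) (hg : IsHarmonic d μ μ0 g) (c : ℝ) :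
    IsHarmonic d μ μ0 fun z => f z - c * g z := by
  intro z
  refine ((hf z).sub ((hg z).mul_left c)).congr_fun fun z' => ?_
  ring

theorem IsHarmonic.const_mul {d : ℕ} {μ μ0 : Zd d → ℝ} {f : St d → ℝ}
    (hf : IsHarmonic d μ μ0 f) (c : ℝ) : IsHarmonic d μ μ0 fun z => c * f z := by
  intro z
  refine ((hf z).mul_left c).congr_fun fun z' => ?_
  ring

theorem exp_neg_mul_translate_le {d : ℕ} {μ μ0 : Zd d → ℝ} (hμ : ∀ w, 0 ≤ μ w)
    (hμ0 : ∀ w, 0 ≤ μ0 w) (hH0 : H0 d μ μ0) (hH1 : H1 d μ μ0) (hH2 : H2 d μ)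
    {h : St d → ℝ} (hh : IsHarmonic d μ μ0 h) (h0 : ∀ z, 0 ≤ h z) (α : Fin (d - 1) → ℝ)
    (hbdd : ∀ y : ℕ, BddAbove (Set.range fun x : Fin (d-1) → ℤ =>
          Real.exp (-(∑ i, α i * (x i : ℝ))) * h (x, y)))
    (e x : Fin (d - 1) → ℤ) (y : ℕ) :
    Real.exp (-(∑ i, α i * (e i : ℝ))) * h (x + e, y) ≤ h (x, y) := by
  set q : ℝ := Real.exp (-(∑ i, α i * (e i : ℝ))) with hq
  have hq0 : 0 < q := Real.exp_pos _
  obtain ⟨M, hM, HM⟩ := exists_harnack_translate hμ hμ0 hH0 hH1 hH2 e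
  let S : Module.End ℝ (St d → ℝ) :=
    { toFun := fun f z => q * f (z.1 + e, z.2)
      map_add' := by intro f g; funext y; simp [mul_add]
      map_smul' := by intro c f; funext y; simp; ring }
  have hSa : ∀ f z, S f z = q * f (z.1 + e, z.2) := fun _ _ => rfl
  have conv : ∀ z, 0 ≤ S (S h) z - 2 * S h z + h z := by
    intro z
    refine second_difference_nonneg S {f | IsHarmonic d μ μ0 f ∧ ∀ y, 0 ≤ f y}
      (mul_pos hq0 hM) (fun f hf => hf.2) ?_ ?_ ⟨hh, h0⟩ z
    · rintro f ⟨hf, hf0⟩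
      refine ⟨?_, fun z => ?_⟩
      · have := (hf.translate e).const_mul ((q * M)⁻¹ * q)
        convert! this using 2
        simp [hSa, mul_assoc]
      · have := hf0 (z.1 + e, z.2)
        simp only [Pi.smul_apply, hSa, smul_eq_mul]
        positivity
    · rintro f ⟨hf, hf0⟩
      refine ⟨?_, fun z => ?_⟩
      · have := hf.sub_const_mul (hf.translate e) ((q * M)⁻¹ * q)
        convert! this using 2
        simp [hSa, mul_assoc]
      · have h1 := HM f hf hf0 z
        simp only [Pi.sub_apply, Pi.smul_apply, hSa, smul_eq_mul]
        have : (q * M)⁻¹ * (q * f (z.1 + e, z.2)) = f (z.1 + e, z.2) / M := by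
          field_simp
        rw [this, sub_nonneg, div_le_iff₀ hM]
        linarith
  obtain ⟨B, hB⟩ := hbdd y
  have := le_of_second_difference_nonneg_of_bounded
    (c := fun k : ℕ => q ^ k * h (x + k • e, y))
    (B := Real.exp (∑ i, α i * (x i : ℝ)) * B) (fun k => ?_) (fun k => ?_)
  · simpa using this
  · have h1 := mul_nonneg (pow_pos hq0 k).le (conv (x + k • e, y))
    simp only [hSa] at h1
    have e1 : x + (k + 1) • e = x + k • e + e := by rw [succ_nsmul, add_assoc]
    have e2 : x + (k + 2) • e = x + k • e + e + e := by
      rw [succ_nsmul, succ_nsmul]; abel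
    rw [e1, e2]
    refine h1.trans_eq ?_
    ring
  · have h1 := hB ⟨x + k • e, rfl⟩
    have h2 : q ^ k = Real.exp (∑ i, α i * (x i : ℝ)) *
        Real.exp (-(∑ i, α i * ((x + k • e) i : ℝ))) := by
      rw [hq, ← Real.exp_nat_mul, ← Real.exp_add]
      congr 1
      simp only [Pi.add_apply, Pi.smul_apply, Int.cast_add, mul_add, Finset.sum_add_distrib]
      rw [neg_add, add_neg_cancel_left, mul_neg, Finset.mul_sum]
      congr 1
      refine Finset.sum_congr rfl fun i _ => ?_
      rw [nsmul_eq_mul]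
      push_cast
      ring
    rw [h2, mul_assoc]
    exact mul_le_mul_of_nonneg_left h1 (Real.exp_pos _).le

theorem eq_exp_mul_of_bounded {d : ℕ} {μ μ0 : Zd d → ℝ} (hμ : ∀ w, 0 ≤ μ w)
    (hμ0 : ∀ w, 0 ≤ μ0 w) (hH0 : H0 d μ μ0) (hH1 : H1 d μ μ0) (hH2 : H2 d μ)
    {h : St d → ℝ} (hh : IsHarmonic d μ μ0 h) (h0 : ∀ z, 0 ≤ h z) (α : Fin (d - 1) → ℝ)
    (hbdd : ∀ y : ℕ, BddAbove (Set.range fun x : Fin (d-1) → ℤ =>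
          Real.exp (-(∑ i, α i * (x i : ℝ))) * h (x, y)))
    (x : Fin (d - 1) → ℤ) (y : ℕ) :
    h (x, y) = Real.exp (∑ i, α i * (x i : ℝ)) * h (0, y) := by
  have h1 := exp_neg_mul_translate_le hμ hμ0 hH0 hH1 hH2 hh h0 α hbdd x 0 y
  have h2 := exp_neg_mul_translate_le hμ hμ0 hH0 hH1 hH2 hh h0 α hbdd (-x) x y
  simp only [zero_add, add_neg_cancel, Pi.neg_apply, Int.cast_neg, mul_neg,
    Finset.sum_neg_distrib, neg_neg] at h1 h2
  refine le_antisymm ?_ h2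
  rwa [Real.exp_neg, inv_mul_le_iff₀ (Real.exp_pos _)] at h1

theorem dotZ_add (d : ℕ) (a : Rd d) (z w : Zd d) : dotZ d a (z + w) = dotZ d a z + dotZ d a w := by
  simp only [dotZ, Prod.fst_add, Prod.snd_add, Pi.add_apply, Int.cast_add, mul_add,
    Finset.sum_add_distrib]
  ring

theorem exp_dotZ_toZ (d : ℕ) (a : Rd d) (z : St d) : Real.exp (dotZ d a (toZ d z)) =
    Real.exp (∑ i, a.1 i * (z.1 i : ℝ)) * Real.exp (a.2 * z.2) := by
  simp [dotZ, toZ, Real.exp_add]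

theorem exp_dotZ_eq_mul {d : ℕ} {a b : Rd d} (h : b.1 = a.1) (w : Zd d) :
    Real.exp (dotZ d b w) = Real.exp (dotZ d a w) * Real.exp ((b.2 - a.2) * w.2) := by
  rw [← Real.exp_add, dotZ, dotZ, h]
  congr 1
  ring

theorem hasSum_state {d : ℕ} {g : Zd d → ℝ} {z : St d} {s : ℝ}
    (hg : ∀ w : Zd d, w.2 < -(z.2 : ℤ) → g w = 0) (h : HasSum g s) :
    HasSum (fun z' => g (toZ d z' - toZ d z)) s := by
  have hinj : Function.Injective fun z' : St d => toZ d z' - toZ d z := by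
    intro u v huv
    have := sub_left_injective huv
    simp only [toZ, Prod.mk.injEq, Nat.cast_inj] at this
    exact Prod.ext this.1 this.2
  refine (hinj.hasSum_iff fun w hw => hg w ?_).2 h
  by_contra! hle
  refine hw ⟨(w.1 + z.1, (w.2 + z.2).toNat), ?_⟩
  refine Prod.ext (by simp [toZ]) ?_
  simp only [toZ, Prod.snd_sub]
  omega

/-- The law of the height increment plus one under `μ` tilted by `b`. -/
noncomputable def heightStep (d : ℕ) (μ : Zd d → ℝ) (b : Rd d) (k : ℕ) : ℝ :=
  ∑' x : Fin (d - 1) → ℤ, μ (x, (k : ℤ) - 1) * Real.exp (dotZ d b (x, (k : ℤ) - 1))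

theorem summable_heightStep {d : ℕ} {μ : Zd d → ℝ} {b : Rd d}
    (hsum : Summable fun w => μ w * Real.exp (dotZ d b w)) (k : ℕ) :
    Summable fun x : Fin (d - 1) → ℤ => μ (x, (k : ℤ) - 1) * Real.exp (dotZ d b (x, (k : ℤ) - 1)) :=
  hsum.comp_injective (i := fun x => ((x, (k : ℤ) - 1) : Zd d)) (Prod.mk_left_injective _)

theorem heightStep_nonneg {d : ℕ} {μ : Zd d → ℝ} (hμ : ∀ w, 0 ≤ μ w) (b : Rd d) (k : ℕ) :
    0 ≤ heightStep d μ b k :=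
  tsum_nonneg fun _ => mul_nonneg (hμ _) (Real.exp_pos _).le

theorem heightStep_pos {d : ℕ} {μ : Zd d → ℝ} (hμ : ∀ w, 0 ≤ μ w) {b : Rd d}
    (hsum : Summable fun w => μ w * Real.exp (dotZ d b w)) {k : ℕ} {w : Zd d}
    (hw : w.2 = (k : ℤ) - 1) (hpos : 0 < μ w) : 0 < heightStep d μ b k := by
  refine (summable_heightStep hsum k).tsum_pos
    (fun x => mul_nonneg (hμ _) (Real.exp_pos _).le) w.1 ?_
  rw [← hw]
  exact mul_pos hpos (Real.exp_pos _)

theorem hasSum_heightStep {d : ℕ} {μ : Zd d → ℝ} (hdown : ∀ w : Zd d, w.2 < -1 → μ w = 0)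
    {b : Rd d} (hsum : Summable fun w => μ w * Real.exp (dotZ d b w))
    {f : ℕ → ℝ} {y : ℕ} {s : ℝ}
    (h : HasSum (fun z' : St d => μ (toZ d z' - toZ d (0, y + 1)) *
      (f z'.2 * Real.exp (dotZ d b (toZ d z')))) (s * Real.exp (dotZ d b (toZ d (0, y + 1))))) :
    HasSum (fun k : ℕ => heightStep d μ b k * f (y + k)) s := by
  have hinj : Function.Injective fun q : ℕ × (Fin (d - 1) → ℤ) => ((q.2, y + q.1) : St d) := by
    intro u v huv
    simp only [Prod.mk.injEq, add_right_inj] at huv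
    exact Prod.ext huv.2 huv.1
  have h1 := (hinj.hasSum_iff fun z' hz' => ?_).2 h
  · refine (hasSum_mul_right_iff (Real.exp_ne_zero (dotZ d b (toZ d (0, y + 1))))).1 ?_
    refine h1.prod_fiberwise fun k => ?_
    refine (((summable_heightStep hsum k).hasSum.mul_right (f (y + k))).mul_right _).congr_fun
      fun x => ?_
    have : toZ d (x, y + k) - toZ d (0, y + 1) = (x, (k : ℤ) - 1) := by
      refine Prod.ext (by simp [toZ]) ?_
      simp only [toZ, Prod.snd_sub]
      push_cast
      ring
    have e1 : Real.exp (dotZ d b (toZ d (x, y + k))) = Real.exp (dotZ d b (x, (k : ℤ) - 1)) *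
        Real.exp (dotZ d b (toZ d (0, y + 1))) := by
      rw [← this, ← Real.exp_add, ← dotZ_add, sub_add_cancel]
    simp only [Function.comp, this, e1]
    ring
  · have : (toZ d z' - toZ d (0, y + 1)).2 < -1 := by
      by_contra! hle
      simp only [toZ, Prod.snd_sub] at hle
      exact hz' ⟨(z'.2 - y, z'.1), Prod.ext rfl (by simp only; omega)⟩
    rw [hdown _ this, zero_mul]

theorem hasSum_mul_exp {d : ℕ} {m : Zd d → ℝ} {a : Rd d} {z : St d} {s : ℝ}
    (hm : ∀ w : Zd d, w.2 < -(z.2 : ℤ) → m w = 0)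
    (h : HasSum (fun w => m w * Real.exp (dotZ d a w)) s) :
    HasSum (fun z' => m (toZ d z' - toZ d z) * Real.exp (dotZ d a (toZ d z')))
      (s * Real.exp (dotZ d a (toZ d z))) := by
  have := (hasSum_state (fun w hw => by rw [hm w hw, zero_mul]) h).mul_right
    (Real.exp (dotZ d a (toZ d z)))
  refine this.congr_fun fun z' => ?_
  rw [mul_assoc, ← Real.exp_add, ← dotZ_add, sub_add_cancel]

theorem hasSum_mul_height_mul_exp {d : ℕ} {m : Zd d → ℝ} {a : Rd d} {z : St d} {s t : ℝ}
    (hm : ∀ w : Zd d, w.2 < -(z.2 : ℤ) → m w = 0)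
    (h : HasSum (fun w => m w * Real.exp (dotZ d a w)) s)
    (h' : HasSum (fun w : Zd d => m w * (w.2 : ℝ) * Real.exp (dotZ d a w)) t) :
    HasSum (fun z' => m (toZ d z' - toZ d z) * ((z'.2 : ℝ) * Real.exp (dotZ d a (toZ d z'))))
      ((z.2 * s + t) * Real.exp (dotZ d a (toZ d z))) := by
  have h1 := (hasSum_mul_exp hm h).mul_left (z.2 : ℝ)
  have h2 := (hasSum_state (fun w hw => by rw [hm w hw, zero_mul, zero_mul]) h').mul_right
    (Real.exp (dotZ d a (toZ d z)))
  convert! h1.add h2 using 1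
  · funext z'
    have e1 : Real.exp (dotZ d a (toZ d z')) = Real.exp (dotZ d a (toZ d z' - toZ d z)) *
        Real.exp (dotZ d a (toZ d z)) := by
      rw [← Real.exp_add, ← dotZ_add, sub_add_cancel]
    have e2 : ((toZ d z' - toZ d z).2 : ℝ) = z'.2 - z.2 := by simp [toZ]
    rw [e1, e2]
    ring
  · ring

theorem summable_mul_height_mul_exp {d : ℕ} {m : Zd d → ℝ} (hm : ∀ w, 0 ≤ m w)
    (hsum : ∀ a : Rd d, Summable fun w => m w * Real.exp (dotZ d a w)) (a : Rd d) :
    Summable fun w : Zd d => m w * (w.2 : ℝ) * Real.exp (dotZ d a w) := by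
  refine Summable.of_norm_bounded ((hsum (a.1, a.2 + 1)).add (hsum (a.1, a.2 - 1))) fun w => ?_
  rw [exp_dotZ_eq_mul (a := a) (b := (a.1, a.2 + 1)) rfl,
    exp_dotZ_eq_mul (a := a) (b := (a.1, a.2 - 1)) rfl, Real.norm_eq_abs, abs_mul, abs_mul,
    abs_of_nonneg (hm w), Real.abs_exp]
  have h1 : |(w.2 : ℝ)| ≤ Real.exp ((a.2 + 1 - a.2) * w.2) + Real.exp ((a.2 - 1 - a.2) * w.2) := by
    have e1 : (a.2 + 1 - a.2) * (w.2 : ℝ) = w.2 := by ring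
    have e2 : (a.2 - 1 - a.2) * (w.2 : ℝ) = -w.2 := by ring
    rw [e1, e2, abs_le]
    have := Real.add_one_le_exp (w.2 : ℝ)
    have := Real.add_one_le_exp (-w.2 : ℝ)
    have := Real.exp_pos (w.2 : ℝ)
    have := Real.exp_pos (-w.2 : ℝ)
    constructor <;> linarith
  have h2 := mul_le_mul_of_nonneg_left h1 (mul_nonneg (hm w) (Real.exp_pos (dotZ d a w)).le)
  refine (le_of_eq ?_).trans (h2.trans (le_of_eq ?_)) <;> ring

/-- Below a point of `∂₋D`, the jump generating function exceeds `1` quadratically. -/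
theorem jgf_lower_bound {d : ℕ} {μ : Zd d → ℝ} (hμ : ∀ w, 0 ≤ μ w)
    (hsum : ∀ a : Rd d, Summable fun w => μ w * Real.exp (dotZ d a w)) {a b : Rd d}
    (ha : a ∈ bdMinus d μ) (hb : b.1 = a.1) (hb2 : b.2 ≤ a.2) {w₀ : Zd d} (hw₀ : w₀.2 = -1) :
    1 + μ w₀ * Real.exp (dotZ d a w₀) * (a.2 - b.2) ^ 2 / 2 ≤ jgf d μ b := by
  classical
  obtain ⟨h1, h2⟩ := ha
  have s1 : HasSum (fun w => μ w * Real.exp (dotZ d a w)) 1 := h1 ▸ (hsum a).hasSum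
  have s2 : HasSum (fun w : Zd d => μ w * (w.2 : ℝ) * Real.exp (dotZ d a w)) (jgfDβ d μ a) :=
    (summable_mul_height_mul_exp hμ hsum a).hasSum
  have s3 := (s1.add (s2.mul_left (b.2 - a.2))).add
    (hasSum_ite_eq w₀ (μ w₀ * Real.exp (dotZ d a w₀) * (a.2 - b.2) ^ 2 / 2))
  refine le_trans ?_ (hasSum_le (fun w => ?_) s3 (hsum b).hasSum)
  · have := mul_nonneg_of_nonpos_of_nonpos (sub_nonpos.2 hb2) h2
    linarith
  · rw [exp_dotZ_eq_mul hb w]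
    have hA := mul_nonneg (hμ w) (Real.exp_pos (dotZ d a w)).le
    split_ifs with hw
    · subst hw
      have h3 := Real.quadratic_le_exp_of_nonneg (sub_nonneg.2 hb2)
      have h4 := mul_le_mul_of_nonneg_left h3 hA
      have h5 : (b.2 - a.2) * (w.2 : ℝ) = a.2 - b.2 := by rw [hw₀]; push_cast; ring
      rw [h5]
      refine (le_of_eq ?_).trans (h4.trans (le_of_eq ?_))
      · rw [hw₀]; push_cast; ring
      · ring
    · have h3 := Real.add_one_le_exp ((b.2 - a.2) * (w.2 : ℝ))
      have h4 := mul_le_mul_of_nonneg_left h3 hA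
      refine (le_of_eq ?_).trans (h4.trans (le_of_eq ?_)) <;> ring

theorem jgf_le_of_le {d : ℕ} {μ0 : Zd d → ℝ} (hμ0 : ∀ w, 0 ≤ μ0 w)
    (hup : ∀ w : Zd d, w.2 < 0 → μ0 w = 0)
    (hsum : ∀ a : Rd d, Summable fun w => μ0 w * Real.exp (dotZ d a w)) {a b : Rd d}
    (hb : b.1 = a.1) (hb2 : a.2 ≤ b.2) : jgf d μ0 a ≤ jgf d μ0 b := by
  refine (hsum a).tsum_le_tsum (fun w => ?_) (hsum b)
  rcases lt_or_ge w.2 0 with hw | hw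
  · simp [hup w hw]
  · rw [exp_dotZ_eq_mul hb w, ← mul_assoc]
    refine le_mul_of_one_le_right (mul_nonneg (hμ0 w) (Real.exp_pos _).le) ?_
    exact Real.one_le_exp (mul_nonneg (sub_nonneg.2 hb2) (by exact_mod_cast hw))

theorem jgf_lt_of_lt {d : ℕ} {μ0 : Zd d → ℝ} (hμ0 : ∀ w, 0 ≤ μ0 w)
    (hup : ∀ w : Zd d, w.2 < 0 → μ0 w = 0)
    (hsum : ∀ a : Rd d, Summable fun w => μ0 w * Real.exp (dotZ d a w)) {a b : Rd d}
    (hb : b.1 = a.1) (hb2 : a.2 < b.2) {w₀ : Zd d} (hw₀ : 0 < w₀.2) (hpos : 0 < μ0 w₀) :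
    jgf d μ0 a < jgf d μ0 b := by
  refine (hsum a).tsum_lt_tsum (i := w₀) (fun w => ?_) ?_ (hsum b)
  · rcases lt_or_ge w.2 0 with hw | hw
    · simp [hup w hw]
    · rw [exp_dotZ_eq_mul hb w, ← mul_assoc]
      refine le_mul_of_one_le_right (mul_nonneg (hμ0 w) (Real.exp_pos _).le) ?_
      exact Real.one_le_exp (mul_nonneg (sub_nonneg.2 hb2.le) (by exact_mod_cast hw))
  · rw [exp_dotZ_eq_mul hb w₀, ← mul_assoc]
    refine lt_mul_of_one_lt_right (mul_pos hpos (Real.exp_pos _)) ?_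
    exact Real.one_lt_exp_iff.2 (mul_pos (sub_pos.2 hb2) (by exact_mod_cast hw₀))

theorem jgfDβ_pos {d : ℕ} {μ0 : Zd d → ℝ} (hμ0 : ∀ w, 0 ≤ μ0 w)
    (hup : ∀ w : Zd d, w.2 < 0 → μ0 w = 0)
    (hsum : ∀ a : Rd d, Summable fun w => μ0 w * Real.exp (dotZ d a w)) (a : Rd d)
    {w₀ : Zd d} (hw₀ : 0 < w₀.2) (hpos : 0 < μ0 w₀) : 0 < jgfDβ d μ0 a := by
  refine (summable_mul_height_mul_exp hμ0 hsum a).tsum_pos (fun w => ?_) w₀ ?_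
  · rcases lt_or_ge w.2 0 with hw | hw
    · simp [hup w hw]
    · exact mul_nonneg (mul_nonneg (hμ0 w) (by exact_mod_cast hw)) (Real.exp_pos _).le
  · exact mul_pos (mul_pos hpos (by exact_mod_cast hw₀)) (Real.exp_pos _)

theorem jgf_le_one_of_mem_Theta {d : ℕ} {μ μ0 : Zd d → ℝ} (hμ : ∀ w, 0 ≤ μ w)
    (hμ0 : ∀ w, 0 ≤ μ0 w) (hup : ∀ w : Zd d, w.2 < 0 → μ0 w = 0)
    (hsum : ∀ a : Rd d, Summable fun w => μ w * Real.exp (dotZ d a w))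
    (hsum0 : ∀ a : Rd d, Summable fun w => μ0 w * Real.exp (dotZ d a w)) {a : Rd d}
    (ha : a ∈ bdMinus d μ) (hΘ : a.1 ∈ Theta d μ μ0) {w₀ : Zd d} (hw₀ : w₀.2 = -1)
    (hpos : 0 < μ w₀) : jgf d μ0 a ≤ 1 := by
  by_contra! hgt
  obtain ⟨s, hs⟩ : ∃ s : Finset (Zd d), 1 < ∑ w ∈ s, μ0 w * Real.exp (dotZ d a w) :=
    ((hsum0 a).hasSum.eventually_const_lt hgt).exists
  have hcont : Continuous fun β : ℝ => ∑ w ∈ s, μ0 w * Real.exp (dotZ d (a.1, β) w) := by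
    unfold dotZ
    fun_prop
  have hev : ∀ᶠ β in nhdsWithin a.2 (Set.Iio a.2),
      1 < ∑ w ∈ s, μ0 w * Real.exp (dotZ d (a.1, β) w) :=
    nhdsWithin_le_nhds (hcont.continuousAt.eventually_const_lt hs)
  obtain ⟨β, hβ, hβlt⟩ := (hev.and self_mem_nhdsWithin).exists
  have hβlt : β < a.2 := hβlt
  have h0 : 1 < jgf d μ0 (a.1, β) :=
    hβ.trans_le ((hsum0 _).sum_le_tsum s fun w _ => mul_nonneg (hμ0 w) (Real.exp_pos _).le)
  set η : ℝ := μ w₀ * Real.exp (dotZ d a w₀) * (a.2 - β) ^ 2 / 2 with hη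
  have hη0 : 0 < η := by
    have := sub_pos.2 hβlt
    have := Real.exp_pos (dotZ d a w₀)
    positivity
  have hle : min (1 + η) (jgf d μ0 (a.1, β)) ≤
      ⨅ β : ℝ, max (jgf d μ (a.1, β)) (jgf d μ0 (a.1, β)) := by
    refine le_ciInf fun γ => ?_
    rcases le_total γ β with h | h
    · refine (min_le_left _ _).trans (le_trans ?_ (le_max_left _ _))
      refine le_trans ?_ (jgf_lower_bound hμ hsum ha (b := (a.1, γ)) rfl (h.trans hβlt.le) hw₀)
      have h1 : (a.2 - β) ^ 2 ≤ (a.2 - γ) ^ 2 :=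
        pow_le_pow_left₀ (sub_pos.2 hβlt).le (by linarith) 2
      have h2 := mul_le_mul_of_nonneg_left h1 (mul_pos hpos (Real.exp_pos (dotZ d a w₀))).le
      simp only [hη]
      linarith
    · exact (min_le_right _ _).trans ((jgf_le_of_le (a := (a.1, β)) (b := (a.1, γ)) hμ0 hup hsum0
        rfl h).trans (le_max_right _ _))
  have hΘ' : (⨅ β : ℝ, max (jgf d μ (a.1, β)) (jgf d μ0 (a.1, β))) ≤ 1 := hΘ
  have : 1 < min (1 + η) (jgf d μ0 (a.1, β)) := lt_min (by linarith) h0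
  linarith

theorem exists_downward_step {d : ℕ} {μ : Zd d → ℝ}
    (hdown : ∀ w : Zd d, w.2 < -1 → μ w = 0) (hH2 : H2 d μ) :
    ∃ w : Zd d, w.2 = -1 ∧ 0 < μ w := by
  by_contra! hno
  obtain ⟨n, hn⟩ := hH2.1 0 (0, -1)
  have := kerIter_invariant (P := fun w : Zd d => 0 ≤ w.2) (fun w w' hw h0 => ?_) hn.ne' (by simp)
  · simp at this
  · have h1 : 0 < μ (w' - w) := by simpa [stepS] using hw
    by_contra! hlt
    rcases lt_or_ge (w' - w).2 (-1) with h2 | h2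
    · exact h1.ne' (hdown _ h2)
    · refine (hno (w' - w) ?_).not_gt h1
      simp only [Prod.snd_sub] at h2 ⊢
      omega

theorem exists_upward_step {d : ℕ} {μ : Zd d → ℝ} (hH2 : H2 d μ) :
    ∃ w : Zd d, 0 < w.2 ∧ 0 < μ w := by
  by_contra! hno
  obtain ⟨n, hn⟩ := hH2.1 0 (0, 1)
  have := kerIter_invariant (P := fun w : Zd d => w.2 ≤ 0) (fun w w' hw h0 => ?_) hn.ne' (by simp)
  · simp at this
  · have h1 : 0 < μ (w' - w) := by simpa [stepS] using hw
    by_contra! hlt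
    refine (hno (w' - w) ?_).not_gt h1
    rw [Prod.snd_sub]
    omega

theorem exists_upward_boundary_step {d : ℕ} {μ μ0 : Zd d → ℝ} (hH1 : H1 d μ μ0) :
    ∃ w : Zd d, 0 < w.2 ∧ 0 < μ0 w := by
  by_contra! hno
  obtain ⟨n, hn⟩ := hH1 0 (0, 1)
  have := kerIter_invariant (P := fun z : St d => z.2 = 0) (fun z z' hz h0 => ?_) hn.ne' (by simp)
  · simp at this
  · have h1 : 0 < μ0 (toZ d z' - toZ d z) := by simpa [step, h0] using hz
    by_contra! hne
    refine (hno _ ?_).not_gt h1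
    simp only [toZ, Prod.snd_sub]
    omega

/-- The function of larger growth among the two separated solutions of the interior equation. -/
noncomputable def growthFun (d : ℕ) (a abar : Rd d) (z : St d) : ℝ :=
  if a = abar then (z.2 : ℝ) * Real.exp (dotZ d a (toZ d z)) else Real.exp (dotZ d a (toZ d z))

/-- The value of `growthFun` at the origin. -/
noncomputable def heightAtBoundary (d : ℕ) (a abar : Rd d) : ℝ := if a = abar then 0 else 1

/-- The mean of `growthFun` after one step from the origin. -/
noncomputable def boundaryMean (d : ℕ) (μ0 : Zd d → ℝ) (a abar : Rd d) : ℝ :=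
  if a = abar then jgfDβ d μ0 a else jgf d μ0 a

theorem exp_dotZ_of_height_zero {d : ℕ} {a b : Rd d} (hb : b.1 = a.1) {z : St d} (hz : z.2 = 0) :
    Real.exp (dotZ d b (toZ d z)) = Real.exp (∑ i, a.1 i * (z.1 i : ℝ)) := by
  rw [exp_dotZ_toZ, hb, hz]
  simp

theorem growthFun_of_height_zero {d : ℕ} {a abar : Rd d} {z : St d} (hz : z.2 = 0) :
    growthFun d a abar z =
      heightAtBoundary d a abar * Real.exp (∑ i, a.1 i * (z.1 i : ℝ)) := by
  unfold growthFun heightAtBoundary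
  split_ifs
  · simp [hz]
  · rw [exp_dotZ_of_height_zero rfl hz, one_mul]

theorem hfun_eq_of_ne {d : ℕ} {μ μ0 : Zd d → ℝ} {a abar : Rd d} (hφ : jgf d μ0 abar ≠ 1)
    (z : St d) : hfun d μ μ0 a abar z = growthFun d a abar z +
      (boundaryMean d μ0 a abar - heightAtBoundary d a abar) / (1 - jgf d μ0 abar) *
        Real.exp (dotZ d abar (toZ d z)) := by
  unfold hfun growthFun boundaryMean heightAtBoundary
  rw [if_neg hφ]
  split_ifs with h
  · subst h
    ring
  · ring

theorem hfun_eq_exp_mul {d : ℕ} {μ μ0 : Zd d → ℝ} {a abar : Rd d} (h1 : abar.1 = a.1)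
    (x : Fin (d - 1) → ℤ) (y : ℕ) : hfun d μ μ0 a abar (x, y) =
      Real.exp (∑ i, a.1 i * (x i : ℝ)) * hfun d μ μ0 a abar (0, y) := by
  have e1 : ∀ b : Rd d, b.1 = a.1 → Real.exp (dotZ d b (toZ d (x, y))) =
      Real.exp (∑ i, a.1 i * (x i : ℝ)) * Real.exp (dotZ d b (toZ d (0, y))) := by
    intro b hb
    simp [exp_dotZ_toZ, hb]
  unfold hfun
  rw [e1 a rfl, e1 abar h1]
  split_ifs <;> ring

theorem hasSum_exp_interior {d : ℕ} {μ : Zd d → ℝ} (hdown : ∀ w : Zd d, w.2 < -1 → μ w = 0)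
    (hsum : ∀ a : Rd d, Summable fun w => μ w * Real.exp (dotZ d a w)) {a : Rd d}
    (ha : jgf d μ a = 1) {z : St d} (hz : z.2 ≠ 0) :
    HasSum (fun z' => μ (toZ d z' - toZ d z) * Real.exp (dotZ d a (toZ d z')))
      (Real.exp (dotZ d a (toZ d z))) := by
  have h1 : HasSum (fun w => μ w * Real.exp (dotZ d a w)) 1 := ha ▸ (hsum a).hasSum
  simpa using hasSum_mul_exp (z := z) (fun w hw => hdown w (by omega)) h1

theorem hasSum_growthFun {d : ℕ} {μ : Zd d → ℝ} (hdown : ∀ w : Zd d, w.2 < -1 → μ w = 0)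
    (hμ : ∀ w, 0 ≤ μ w)
    (hsum : ∀ a : Rd d, Summable fun w => μ w * Real.exp (dotZ d a w)) {a abar : Rd d}
    (ha : a ∈ bdPlus d μ) (habar : abar ∈ bdMinus d μ) {z : St d} (hz : z.2 ≠ 0) :
    HasSum (fun z' => μ (toZ d z' - toZ d z) * growthFun d a abar z')
      (growthFun d a abar z) := by
  unfold growthFun
  split_ifs with h
  · subst h
    have h1 : HasSum (fun w => μ w * Real.exp (dotZ d a w)) 1 := ha.1 ▸ (hsum a).hasSum
    have h2 : HasSum (fun w : Zd d => μ w * (w.2 : ℝ) * Real.exp (dotZ d a w)) 0 :=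
      le_antisymm habar.2 ha.2 ▸ (summable_mul_height_mul_exp hμ hsum a).hasSum
    simpa using hasSum_mul_height_mul_exp (z := z) (fun w hw => hdown w (by omega)) h1 h2
  · exact hasSum_exp_interior hdown hsum ha.1 hz

theorem hasSum_combination_boundary {d : ℕ} {μ0 : Zd d → ℝ}
    (hμ0 : ∀ w, 0 ≤ μ0 w) (hup : ∀ w : Zd d, w.2 < 0 → μ0 w = 0)
    (hsum0 : ∀ a : Rd d, Summable fun w => μ0 w * Real.exp (dotZ d a w)) {a abar : Rd d}
    (h1 : abar.1 = a.1) (A B : ℝ) {z : St d} (hz : z.2 = 0) :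
    HasSum (fun z' => μ0 (toZ d z' - toZ d z) * (A * growthFun d a abar z' +
        B * Real.exp (dotZ d abar (toZ d z'))))
      ((A * boundaryMean d μ0 a abar + B * jgf d μ0 abar) *
        Real.exp (∑ i, a.1 i * (z.1 i : ℝ))) := by
  have hz' : ∀ w : Zd d, w.2 < -(z.2 : ℤ) → μ0 w = 0 := fun w hw => hup w (by omega)
  have e1 := (hasSum_mul_exp hz' (hsum0 abar).hasSum).mul_left B
  have e2 : HasSum (fun z' => μ0 (toZ d z' - toZ d z) * growthFun d a abar z')
      (boundaryMean d μ0 a abar * Real.exp (∑ i, a.1 i * (z.1 i : ℝ))) := by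
    unfold growthFun boundaryMean
    rw [← exp_dotZ_of_height_zero (b := a) rfl hz]
    split_ifs
    · have := hasSum_mul_height_mul_exp hz' (hsum0 a).hasSum
        (summable_mul_height_mul_exp hμ0 hsum0 a).hasSum
      simpa [hz] using! this
    · exact hasSum_mul_exp hz' (hsum0 a).hasSum
  rw [exp_dotZ_of_height_zero h1 hz] at e1
  convert! (e2.mul_left A).add e1 using 1
  · funext z'
    ring
  · unfold jgf
    ring

theorem snd_lt_of_ne {d : ℕ} {μ : Zd d → ℝ} (hμ : ∀ w, 0 ≤ μ w)
    (hsum : ∀ a : Rd d, Summable fun w => μ w * Real.exp (dotZ d a w)) {a abar : Rd d}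
    (ha : jgf d μ a = 1) (habar : abar ∈ bdMinus d μ) (h1 : abar.1 = a.1) (hne : a ≠ abar)
    {w₀ : Zd d} (hw₀ : w₀.2 = -1) (hpos : 0 < μ w₀) : abar.2 < a.2 := by
  by_contra! hle
  have h2 := jgf_lower_bound hμ hsum habar h1.symm hle hw₀
  have hlt : 0 < abar.2 - a.2 :=
    sub_pos.2 (lt_of_le_of_ne hle fun h => hne (Prod.ext h1.symm h))
  have : 0 < μ w₀ * Real.exp (dotZ d abar w₀) * (abar.2 - a.2) ^ 2 / 2 := by
    have := Real.exp_pos (dotZ d abar w₀)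
    positivity
  linarith

theorem heightAtBoundary_mul_lt {d : ℕ} {μ0 : Zd d → ℝ} (hμ0 : ∀ w, 0 ≤ μ0 w)
    (hup : ∀ w : Zd d, w.2 < 0 → μ0 w = 0)
    (hsum0 : ∀ a : Rd d, Summable fun w => μ0 w * Real.exp (dotZ d a w)) {a abar : Rd d}
    (h1 : abar.1 = a.1) (hlt : a ≠ abar → abar.2 < a.2) {w₀ : Zd d} (hw₀ : 0 < w₀.2)
    (hpos : 0 < μ0 w₀) :
    heightAtBoundary d a abar * jgf d μ0 abar < boundaryMean d μ0 a abar := by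
  unfold heightAtBoundary boundaryMean
  split_ifs with h
  · rw [zero_mul]
    exact jgfDβ_pos hμ0 hup hsum0 a hw₀ hpos
  · rw [one_mul]
    exact jgf_lt_of_lt hμ0 hup hsum0 h1.symm (hlt h) hw₀ hpos

theorem heightAtBoundary_mul_exp_le {d : ℕ} {a abar : Rd d} (h1 : abar.1 = a.1)
    (hlt : a ≠ abar → abar.2 < a.2) (z : St d) :
    heightAtBoundary d a abar * Real.exp (dotZ d abar (toZ d z)) ≤ growthFun d a abar z := by
  unfold heightAtBoundary growthFun
  split_ifs with h
  · rw [zero_mul]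
    positivity
  · rw [one_mul, exp_dotZ_toZ, exp_dotZ_toZ, h1]
    have := mul_le_mul_of_nonneg_right (hlt h).le (Nat.cast_nonneg (α := ℝ) z.2)
    gcongr

/-- Separated nonnegative harmonic functions combine the two separated interior solutions. -/
theorem exists_eq_growthFun_add {d : ℕ} {μ μ0 : Zd d → ℝ} (hμ : ∀ w, 0 ≤ μ w)
    (hdown : ∀ w : Zd d, w.2 < -1 → μ w = 0)
    (hsum : ∀ a : Rd d, Summable fun w => μ w * Real.exp (dotZ d a w)) {a abar : Rd d}
    (ha : a ∈ bdPlus d μ) (habar : abar ∈ bdMinus d μ) (h1 : abar.1 = a.1)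
    (hlt : a ≠ abar → abar.2 < a.2) {w₁ w₂ : Zd d} (hw₁ : w₁.2 = -1) (hw₁pos : 0 < μ w₁)
    (hw₂ : 0 < w₂.2) (hw₂pos : 0 < μ w₂) {h : St d → ℝ} (hh : IsHarmonic d μ μ0 h)
    (h0 : ∀ z, 0 ≤ h z)
    (hsep : ∀ x y, h (x, y) = Real.exp (∑ i, a.1 i * (x i : ℝ)) * h (0, y)) :
    ∃ A B : ℝ, 0 ≤ A ∧ ∀ z, h z =
      A * growthFun d a abar z + B * Real.exp (dotZ d abar (toZ d z)) := by
  have hint : ∀ y : ℕ, ((0, y + 1) : St d).2 ≠ 0 := fun y => Nat.succ_ne_zero y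
  have hexp1 := (hsum abar).hasSum
  rw [show ∑' w, μ w * Real.exp (dotZ d abar w) = 1 from habar.1] at hexp1
  have hp1 : HasSum (heightStep d μ abar) 1 := by
    have := hasSum_heightStep (f := fun _ => 1) (y := 0) (s := 1) hdown (hsum abar)
      (by simpa only [one_mul] using hasSum_exp_interior hdown hsum habar.1 (hint 0))
    simpa only [mul_one] using this
  have hpm : HasSum (fun k => heightStep d μ abar k * k) (1 + jgfDβ d μ abar) := by
    have hz : ∀ w : Zd d, w.2 < -((((0, 1) : St d).2 : ℕ) : ℤ) → μ w = 0 :=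
      fun w hw => hdown w (by push_cast at hw; omega)
    have e2 := hasSum_mul_height_mul_exp hz hexp1 (summable_mul_height_mul_exp hμ hsum abar).hasSum
    have := hasSum_heightStep (f := fun y => (y : ℝ)) (y := 0) (s := 1 + jgfDβ d μ abar) hdown
      (hsum abar) (by simpa [jgfDβ] using e2)
    simpa only [zero_add] using this
  set g : ℕ → ℝ := fun y => if a = abar then (y : ℝ) else Real.exp ((a.2 - abar.2) * y) with hg
  have hgrow : ∀ z : St d, growthFun d a abar z =
      g z.2 * Real.exp (dotZ d abar (toZ d z)) := by
    intro z
    simp only [growthFun, hg]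
    split_ifs with h
    · rw [h]
    · rw [exp_dotZ_eq_mul h1.symm, mul_comm]
      simp [toZ]
  have hG : ∀ y, HasSum (fun k => heightStep d μ abar k * g (y + k)) (g (y + 1)) := by
    intro y
    have e1 := hasSum_growthFun hdown hμ hsum ha habar (hint y)
    simp only [hgrow] at e1
    exact hasSum_heightStep hdown (hsum abar) e1
  have hcancel : ∀ y : ℕ, Real.exp (-(abar.2 * y)) * Real.exp (abar.2 * y) = 1 := fun y => by
    rw [← Real.exp_add, neg_add_cancel, Real.exp_zero]
  have hheight : ∀ z : St d, h z =
      h (0, z.2) * Real.exp (-(abar.2 * z.2)) * Real.exp (dotZ d abar (toZ d z)) := by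
    intro z
    rw [exp_dotZ_toZ, h1, mul_left_comm, mul_assoc, hcancel, mul_one]
    exact hsep z.1 z.2
  have hF : ∀ y : ℕ, HasSum (fun k => heightStep d μ abar k *
      (h (0, y + k) * Real.exp (-(abar.2 * (y + k : ℕ)))))
      (h (0, y + 1) * Real.exp (-(abar.2 * (y + 1 : ℕ)))) := by
    intro y
    refine hasSum_heightStep (f := fun y : ℕ => h (0, y) * Real.exp (-(abar.2 * y))) hdown
      (hsum abar) ?_
    have e1 := hh (0, y + 1)
    simp only [stepR, if_neg (hint y)] at e1
    rw [hheight (0, y + 1)] at e1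
    exact e1.congr_fun fun z' => by rw [← hheight]
  have hinc : ∃ c r : ℝ, 0 < c ∧ 0 < r ∧ ∀ y, g (y + 1) - g y = c * r ^ y := by
    by_cases h : a = abar
    · exact ⟨1, 1, one_pos, one_pos, fun y => by simp [hg, h]⟩
    · refine ⟨Real.exp (a.2 - abar.2) - 1, Real.exp (a.2 - abar.2), ?_, Real.exp_pos _,
        fun y => ?_⟩
      · exact sub_pos.2 (Real.one_lt_exp_iff.2 (sub_pos.2 (hlt h)))
      · simp only [hg, if_neg h]
        have : Real.exp ((a.2 - abar.2) * (y + 1 : ℕ)) =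
            Real.exp ((a.2 - abar.2) * y) * Real.exp (a.2 - abar.2) := by
          rw [← Real.exp_add]
          push_cast
          ring_nf
        rw [this, ← Real.exp_nat_mul, mul_comm (y : ℝ)]
        ring
  obtain ⟨c, r, hc, hr, hcr⟩ := hinc
  obtain ⟨A, B, hA, hAB⟩ := exists_eq_add_of_harmonic
    (F := fun y : ℕ => h (0, y) * Real.exp (-(abar.2 * y)))
    (heightStep_nonneg hμ abar) (heightStep_pos hμ (hsum abar) (by simpa using hw₁) hw₁pos)
    ⟨(w₂.2 - 1).toNat, heightStep_pos hμ (hsum abar) (by push_cast; omega) hw₂pos⟩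
    hp1 hpm (by linarith [habar.2]) (fun y => mul_nonneg (h0 _) (Real.exp_pos _).le) hF hG
    hc hr hcr
  refine ⟨A, B, hA, fun z => ?_⟩
  rw [hheight, hgrow, hAB]
  ring

/-- for `a = (α,β) ∈ (Θ×ℝ)∩∂₊D`, the constant positive multiples of
`h_a` are the only nonzero nonnegative harmonic functions `h` with
`sup_x e^{-α·x} h(x,y) < ∞` for every `y`. -/
theorem harmonic_growth_characterization
    (d : ℕ) (hd : 2 ≤ d) (μ μ0 : Zd d → ℝ)
    (hμ : IsProb d μ) (hμ0 : IsProb d μ0)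
    (hH0 : H0 d μ μ0) (hH1 : H1 d μ μ0) (hH2 : H2 d μ)
    (hH3 : H3 d μ μ0) (hH4 : H4 d μ μ0)
    (a abar : Rd d) (ha : a.1 ∈ Theta d μ μ0 ∧ a ∈ bdPlus d μ)
    (habar : abar ∈ bdMinus d μ ∧ abar.1 = a.1) :
    ∀ h : St d → ℝ,
      (IsHarmonic d μ μ0 h ∧ (∀ z, 0 ≤ h z) ∧ h ≠ 0 ∧
        ∀ y : ℕ, BddAbove (Set.range fun x : Fin (d-1) → ℤ =>
          Real.exp (-(∑ i, a.1 i * (x i : ℝ))) * h (x, y)))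
      ↔ ∃ c : ℝ, 0 < c ∧ h = fun z => c * hfun d μ μ0 a abar z := by
  obtain ⟨hα, ha⟩ := ha
  obtain ⟨habar, h1⟩ := habar
  obtain ⟨w₁, hw₁, hw₁pos⟩ := exists_downward_step hH0.1 hH2
  obtain ⟨w₂, hw₂, hw₂pos⟩ := exists_upward_step hH2
  obtain ⟨w₃, hw₃, hw₃pos⟩ := exists_upward_boundary_step hH1
  have hsum : ∀ b : Rd d, Summable fun w => μ w * Real.exp (dotZ d b w) := fun b => (hH4 b).1
  have hsum0 : ∀ b : Rd d, Summable fun w => μ0 w * Real.exp (dotZ d b w) := fun b => (hH4 b).2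
  have hle : jgf d μ0 abar ≤ 1 := by
    rw [← h1] at hα
    exact jgf_le_one_of_mem_Theta hμ.1 hμ0.1 hH0.2 hsum hsum0 habar hα hw₁ hw₁pos
  have hlt : a ≠ abar → abar.2 < a.2 := fun hne =>
    snd_lt_of_ne hμ.1 hsum ha.1 habar h1 hne hw₁ hw₁pos
  have hστ := heightAtBoundary_mul_lt hμ0.1 hH0.2 hsum0 h1 hlt hw₃ hw₃pos
  intro h
  constructor
  · rintro ⟨hh, h0, hne, hbdd⟩
    have hsep := eq_exp_mul_of_bounded hμ.1 hμ0.1 hH0 hH1 hH2 hh h0 a.1 hbdd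
    obtain ⟨A, B, hA, hAB⟩ := exists_eq_growthFun_add hμ.1 hH0.1 hsum ha habar h1 hlt hw₁ hw₁pos
      hw₂ hw₂pos hh h0 hsep
    have hbd := hasSum_combination_boundary hμ0.1 hH0.2 hsum0 h1 A B (z := (0 : St d)) rfl
    have hbd' := hh 0
    simp only [stepR, Prod.snd_zero, if_true] at hbd'
    simp only [← hAB] at hbd
    have heq := hbd.unique hbd'
    rw [hAB, growthFun_of_height_zero rfl, exp_dotZ_of_height_zero h1 rfl] at heq
    have hbal : A * boundaryMean d μ0 a abar + B * jgf d μ0 abar =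
        A * heightAtBoundary d a abar + B := by
      simpa using heq
    by_cases hφ : jgf d μ0 abar = 1
    · have hA0 : A = 0 := by
        rw [hφ] at hbal hστ
        have : A * (boundaryMean d μ0 a abar - heightAtBoundary d a abar) = 0 := by linarith
        rcases mul_eq_zero.1 this with h2 | h2
        · exact h2
        · linarith
      have hB : 0 < B := by
        have hB0 := h0 0
        rw [hAB, hA0, zero_mul, zero_add] at hB0
        refine lt_of_le_of_ne (nonneg_of_mul_nonneg_left hB0 (Real.exp_pos _)) fun hB => hne ?_
        funext z
        simp [hAB, hA0, ← hB]
      refine ⟨B, hB, funext fun z => ?_⟩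
      rw [hAB, hA0, hfun, if_pos hφ]
      ring
    · have hpos : 0 < 1 - jgf d μ0 abar := sub_pos.2 (lt_of_le_of_ne hle hφ)
      have hB : B = A * ((boundaryMean d μ0 a abar - heightAtBoundary d a abar) /
          (1 - jgf d μ0 abar)) := by
        rw [mul_div_assoc', eq_div_iff hpos.ne']
        linarith
      have hh' : h = fun z => A * hfun d μ μ0 a abar z := by
        funext z
        rw [hAB, hfun_eq_of_ne hφ, hB]
        ring
      refine ⟨A, lt_of_le_of_ne hA fun hA0 => hne ?_, hh'⟩
      rw [hh', ← hA0]
      funext z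
      simp
  · rintro ⟨c, hc, rfl⟩
    have hpos : ∀ z, 0 < hfun d μ μ0 a abar z := fun z => by
      by_cases hφ : jgf d μ0 abar = 1
      · rw [hfun, if_pos hφ]
        exact Real.exp_pos _
      · rw [hfun_eq_of_ne hφ]
        have hp : 0 < 1 - jgf d μ0 abar := sub_pos.2 (lt_of_le_of_ne hle hφ)
        have hk : -heightAtBoundary d a abar <
            (boundaryMean d μ0 a abar - heightAtBoundary d a abar) / (1 - jgf d μ0 abar) := by
          rw [lt_div_iff₀ hp]
          linarith
        have h2 := heightAtBoundary_mul_exp_le h1 hlt z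
        have h3 := Real.exp_pos (dotZ d abar (toZ d z))
        nlinarith
    refine ⟨fun z => ?_, fun z => (mul_pos hc (hpos z)).le, fun hzero => ?_, fun y => ?_⟩
    · have hz : ∃ A B : ℝ, (∀ z, hfun d μ μ0 a abar z =
          A * growthFun d a abar z + B * Real.exp (dotZ d abar (toZ d z))) ∧
          A * boundaryMean d μ0 a abar + B * jgf d μ0 abar =
            A * heightAtBoundary d a abar + B := by
        by_cases hφ : jgf d μ0 abar = 1
        · refine ⟨0, 1, fun z => ?_, by rw [hφ]; ring⟩
          rw [hfun, if_pos hφ]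
          ring
        · have hp : 1 - jgf d μ0 abar ≠ 0 := sub_ne_zero.2 (Ne.symm hφ)
          refine ⟨1, _, fun z => by rw [hfun_eq_of_ne hφ, one_mul], ?_⟩
          field_simp
          ring
      obtain ⟨A, B, hAB, hbal⟩ := hz
      simp only [hAB]
      have key : HasSum (fun z' => stepR d μ μ0 z z' * (A * growthFun d a abar z' +
          B * Real.exp (dotZ d abar (toZ d z'))))
          (A * growthFun d a abar z + B * Real.exp (dotZ d abar (toZ d z))) := by
        by_cases hz0 : z.2 = 0
        · have := hasSum_combination_boundary hμ0.1 hH0.2 hsum0 h1 A B hz0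
          simp only [stepR, if_pos hz0]
          rw [growthFun_of_height_zero hz0, exp_dotZ_of_height_zero h1 hz0]
          convert! this using 1
          rw [hbal]
          ring
        · simp only [stepR, if_neg hz0]
          have h2 := (hasSum_growthFun hH0.1 hμ.1 hsum ha habar hz0).mul_left A
          have h3 := (hasSum_exp_interior hH0.1 hsum habar.1 hz0).mul_left B
          refine (h2.add h3).congr_fun fun z' => ?_
          ring
      refine (key.mul_left c).congr_fun fun z' => ?_
      ring
    · exact (mul_pos hc (hpos 0)).ne' (congrFun hzero 0)
    · refine ⟨c * hfun d μ μ0 a abar (0, y), ?_⟩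
      rintro _ ⟨x, rfl⟩
      refine le_of_eq ?_
      simp only
      rw [hfun_eq_exp_mul h1, Real.exp_neg]
      field_simp

end ReflectedRW
end

section
/- Under hypotheses (H0)-(H3), the Markov chain (Z(t)) satisfies the communication condition on ℤ^{d−1}×ℕ: there exist θ > 0 and C > 0 such that for any z, z' ∈ ℤ^{d−1}×ℕ there is a sequence of points z₀, z₁, …, z_n ∈ ℤ^{d−1}×ℕ with z₀ = z, z_n = z', n ≤ C|z'−z|, and such that |z_i − z_{i−1}| ≤ C and P_{z_{i−1}}(Z(1) = z_i) ≥ θ for every i = 1, …, n. -/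
open scoped ENNReal
open Filter MeasureTheory

namespace ReflectedRW

/-- `HasPath r n a b`: there is an `n`-step path from `a` to `b` whose steps satisfy `r`. -/
def HasPath {S : Type*} (r : S → S → Prop) (n : ℕ) (a b : S) : Prop :=
  ∃ w : ℕ → S, w 0 = a ∧ w n = b ∧ ∀ i < n, r (w i) (w (i + 1))

namespace HasPath

variable {S : Type*} {r s : S → S → Prop} {m n : ℕ} {a b c : S}

theorem refl (r : S → S → Prop) (a : S) : HasPath r 0 a a :=
  ⟨fun _ => a, rfl, rfl, fun i hi => absurd hi (Nat.not_lt_zero i)⟩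

theorem mono (h : HasPath r n a b) (hrs : ∀ x y, r x y → s x y) : HasPath s n a b := by
  obtain ⟨w, h0, hn, hw⟩ := h
  exact ⟨w, h0, hn, fun i hi => hrs _ _ (hw i hi)⟩

theorem single (h : r a b) : HasPath r 1 a b := by
  refine ⟨fun i => if i = 0 then a else b, by simp, by simp, fun i hi => ?_⟩
  obtain rfl : i = 0 := by omega
  simpa using h

theorem trans (h₁ : HasPath r m a b) (h₂ : HasPath r n b c) : HasPath r (m + n) a c := by
  obtain ⟨u, hu0, hum, hu⟩ := h₁
  obtain ⟨v, hv0, hvn, hv⟩ := h₂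
  refine ⟨fun i => if i < m then u i else v (i - m), ?_, ?_, fun i hi => ?_⟩
  · rcases Nat.eq_zero_or_pos m with rfl | hm
    · simp [hv0, ← hum, hu0]
    · simp [hm, hu0]
  · simp [hvn]
  · rcases lt_trichotomy (i + 1) m with h | h | h
    · have h' : i < m := by omega
      simpa [h, h'] using hu i h'
    · have h' : i < m := by omega
      have := hu i h'
      rw [h, hum, ← hv0] at this
      simpa [h, h'] using this
    · have h₁ : ¬ i < m := by omega
      have h₂ : ¬ i + 1 < m := by omega
      have h₃ : i + 1 - m = i - m + 1 := by omega
      simpa [h₁, h₂, h₃] using hv (i - m) (by omega)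

end HasPath

theorem exists_pos_of_kerIter_succ_pos {S : Type*} [DecidableEq S] {p : S → S → ℝ≥0∞} {n : ℕ}
    {a b : S} (h : 0 < kerIter p (n + 1) a b) : ∃ c, 0 < kerIter p n a c ∧ 0 < p c b := by
  by_contra! hc
  refine h.ne' ?_
  simp only [kerIter, ENNReal.tsum_eq_zero, mul_eq_zero]
  intro c
  by_cases hac : kerIter p n a c = 0
  · exact Or.inl hac
  · exact Or.inr (nonpos_iff_eq_zero.1 (hc c (pos_iff_ne_zero.2 hac)))

theorem eq_of_kerIter_zero_pos {S : Type*} [DecidableEq S] {p : S → S → ℝ≥0∞}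
    {a b : S} (h : 0 < kerIter p 0 a b) : a = b := by
  by_contra hab
  simp [kerIter, hab] at h

/-- The steps of length at most `C` and probability at least `C⁻¹`. -/
def GoodStep (d : ℕ) (μ μ0 : Zd d → ℝ) (C : ℝ) (z z' : St d) : Prop :=
  ‖toR d (toZ d z' - toZ d z)‖ ≤ C ∧ C⁻¹ ≤ stepR d μ μ0 z z'

section

variable {d : ℕ} {μ μ0 : Zd d → ℝ}

theorem GoodStep.mono {C C' : ℝ} (hC : 0 < C) (hCC' : C ≤ C') {z z' : St d}
    (h : GoodStep d μ μ0 C z z') : GoodStep d μ μ0 C' z z' :=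
  ⟨h.1.trans hCC', (inv_anti₀ hC hCC').trans h.2⟩

theorem eventually_inv_le {x : ℝ} (hx : 0 < x) : ∀ᶠ C : ℝ in atTop, C⁻¹ ≤ x := by
  filter_upwards [eventually_ge_atTop x⁻¹] with C hC
  exact inv_le_of_inv_le₀ hx hC

/-- Horizontal translation of a state. -/
def shift (x : Fin (d - 1) → ℤ) (z : St d) : St d := (x + z.1, z.2)

theorem toZ_shift_sub (x : Fin (d - 1) → ℤ) (z z' : St d) :
    toZ d (shift x z') - toZ d (shift x z) = toZ d z' - toZ d z := by
  simp [toZ, shift]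

theorem toZ_injective : Function.Injective (toZ d) := by
  rintro ⟨x, y⟩ ⟨x', y'⟩ h
  simpa [toZ] using h

theorem stepR_shift (x : Fin (d - 1) → ℤ) (z z' : St d) :
    stepR d μ μ0 (shift x z) (shift x z') = stepR d μ μ0 z z' := by
  unfold stepR
  rw [toZ_shift_sub]
  rfl

theorem stepR_pos_of_step_pos {z z' : St d} (h : 0 < step d μ μ0 z z') :
    0 < stepR d μ μ0 z z' := by
  unfold step at h
  unfold stepR
  split_ifs at h ⊢ <;> exact ENNReal.ofReal_pos.1 h

theorem eventually_hasPath_shift_of_stepn_pos {n : ℕ} {z z' : St d}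
    (h : 0 < stepn d μ μ0 n z z') :
    ∀ᶠ C : ℝ in atTop, ∀ x, HasPath (GoodStep d μ μ0 C) n (shift x z) (shift x z') := by
  induction n generalizing z' with
  | zero =>
    obtain rfl := eq_of_kerIter_zero_pos h
    exact Eventually.of_forall fun C x => HasPath.refl _ _
  | succ n ih =>
    obtain ⟨c, hc, hcz⟩ := exists_pos_of_kerIter_succ_pos h
    filter_upwards [ih hc, eventually_ge_atTop ‖toR d (toZ d z' - toZ d c)‖,
      eventually_inv_le (stepR_pos_of_step_pos hcz)] with C h₁ h₂ h₃ x
    refine (h₁ x).trans (HasPath.single ⟨?_, ?_⟩)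
    · rwa [toZ_shift_sub]
    · rwa [stepR_shift]

theorem eventually_hasPath_of_stepSn_pos {n : ℕ} {a b : Zd d} (h : 0 < stepSn d μ n a b) :
    ∀ᶠ C : ℝ in atTop, ∀ z z' : St d, C ≤ z.2 → toZ d z' = toZ d z + (b - a) →
      HasPath (GoodStep d μ μ0 C) n z z' := by
  induction n generalizing b with
  | zero =>
    obtain rfl := eq_of_kerIter_zero_pos h
    refine Eventually.of_forall fun C z z' _ hz => ?_
    obtain rfl : z' = z := toZ_injective (by simpa using hz)
    exact HasPath.refl _ _
  | succ n ih =>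
    obtain ⟨c, hc, hcb⟩ := exists_pos_of_kerIter_succ_pos h
    have hcb' : 0 < μ (b - c) := ENNReal.ofReal_pos.1 hcb
    filter_upwards [ih hc, eventually_ge_atTop ‖toR d (b - c)‖, eventually_inv_le hcb',
      eventually_gt_atTop (-((c - a).2 : ℝ))] with C h₁ h₂ h₃ h₄ z z' hz hzz'
    have hpos : 0 < (z.2 : ℤ) + (c - a).2 := by
      have : (0 : ℝ) < (z.2 : ℝ) + ((c - a).2 : ℝ) := by linarith
      exact_mod_cast this
    let u : St d := (z.1 + (c - a).1, ((z.2 : ℤ) + (c - a).2).toNat)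
    have hu : toZ d u = toZ d z + (c - a) := by
      refine Prod.ext rfl ?_
      simpa [toZ, u] using hpos.le
    have hu2 : u.2 ≠ 0 := by
      simp only [u]
      omega
    have hdiff : toZ d z' - toZ d u = b - c := by
      rw [hzz', hu]
      abel
    refine (h₁ z u hz hu).trans (HasPath.single ⟨?_, ?_⟩)
    · rwa [hdiff]
    · rwa [stepR, if_neg hu2, hdiff]

theorem eventually_hasPath_of_height (hH1 : H1 d μ μ0) (v : Zd d) (y : ℕ) :
    ∀ᶠ C : ℝ in atTop, ∀ z z' : St d, z.2 = y → toZ d z' = toZ d z + v →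
      ∃ n : ℕ, (n : ℝ) ≤ C ∧ HasPath (GoodStep d μ μ0 C) n z z' := by
  obtain ⟨n, hn⟩ := hH1 (0, y) (v.1, ((y : ℤ) + v.2).toNat)
  filter_upwards [eventually_hasPath_shift_of_stepn_pos hn, eventually_ge_atTop (n : ℝ)]
    with C hC hnC z z' hz hzz'
  refine ⟨n, hnC, ?_⟩
  have h₁ : shift z.1 (0, y) = z := by simp [shift, ← hz]
  have h₂ : shift z.1 (v.1, ((y : ℤ) + v.2).toNat) = z' := by
    have e₁ : z'.1 = z.1 + v.1 := congrArg Prod.fst hzz'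
    have e₂ : (z'.2 : ℤ) = z.2 + v.2 := congrArg Prod.snd hzz'
    refine Prod.ext e₁.symm ?_
    simp only [shift]
    omega
  simpa only [h₁, h₂] using hC z.1

theorem eventually_hasPath_add (hH1 : H1 d μ μ0) (hH2 : H2 d μ) (v : Zd d) :
    ∀ᶠ C : ℝ in atTop, ∀ z z' : St d, toZ d z' = toZ d z + v →
      ∃ n : ℕ, (n : ℝ) ≤ C ∧ HasPath (GoodStep d μ μ0 C) n z z' := by
  obtain ⟨n, hn⟩ := hH2.1 0 v
  obtain ⟨C₀, hC₀, hpos⟩ := ((eventually_hasPath_of_stepSn_pos (μ0 := μ0) hn).and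
    (eventually_gt_atTop 0)).exists
  filter_upwards [eventually_ge_atTop C₀, eventually_ge_atTop (n : ℝ),
    (eventually_all_finset (Finset.range ⌈C₀⌉₊)).2
      fun y _ => eventually_hasPath_of_height hH1 v y] with C hC hnC hlow z z' hzz'
  rcases le_or_gt C₀ z.2 with h | h
  · exact ⟨n, hnC, (hC₀ z z' h (by simpa using hzz')).mono fun _ _ => GoodStep.mono hpos hC⟩
  · exact hlow z.2 (Finset.mem_range.2 (Nat.lt_ceil.2 h)) z z' rfl hzz'

theorem exists_hasPath_of_unit (hH1 : H1 d μ μ0) (hH2 : H2 d μ) :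
    ∃ C : ℝ, 0 < C ∧ ∀ z z' : St d, toZ d z' - toZ d z ∈ Set.Icc (-1) 1 →
      ∃ n : ℕ, (n : ℝ) ≤ C ∧ HasPath (GoodStep d μ μ0 C) n z z' := by
  have hfin : (Set.Icc (-1 : Zd d) 1).Finite := by
    rw [Set.Icc_prod_eq]
    exact (Set.finite_Icc _ _).prod (Set.finite_Icc _ _)
  obtain ⟨C, hC, hpos⟩ := (((eventually_all_finite hfin).2
    fun v _ => eventually_hasPath_add hH1 hH2 v).and (eventually_gt_atTop 0)).exists
  exact ⟨C, hpos, fun z z' h => hC _ h z z' (by abel)⟩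

theorem exists_hasPath_of_natAbs_le {r : St d → St d → Prop} {C : ℝ}
    (hunit : ∀ z z' : St d, toZ d z' - toZ d z ∈ Set.Icc (-1) 1 →
      ∃ n : ℕ, (n : ℝ) ≤ C ∧ HasPath r n z z')
    (N : ℕ) (z z' : St d) (h₁ : ∀ i, (z'.1 i - z.1 i).natAbs ≤ N)
    (h₂ : ((z'.2 : ℤ) - z.2).natAbs ≤ N) :
    ∃ n : ℕ, (n : ℝ) ≤ C * N ∧ HasPath r n z z' := by
  induction N generalizing z with
  | zero =>
    obtain rfl : z' = z := by
      refine Prod.ext (funext fun i => ?_) ?_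
      · have := h₁ i
        omega
      · omega
    exact ⟨0, by simp, HasPath.refl _ _⟩
  | succ N ih =>
    let u : St d := (fun i => z.1 i + (z'.1 i - z.1 i).sign,
      ((z.2 : ℤ) + ((z'.2 : ℤ) - z.2).sign).toNat)
    have key : ∀ t : ℤ, (t.natAbs ≤ N + 1) → (t - t.sign).natAbs ≤ N := by
      intro t ht
      rcases lt_trichotomy t 0 with h | h | h
      · rw [Int.sign_eq_neg_one_of_neg h]; omega
      · simp [h]
      · rw [Int.sign_eq_one_of_pos h]; omega
    have sign_mem : ∀ t : ℤ, -1 ≤ t.sign ∧ t.sign ≤ 1 := by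
      intro t
      rcases lt_trichotomy t 0 with h | h | h
      · simp [Int.sign_eq_neg_one_of_neg h]
      · simp [h]
      · simp [Int.sign_eq_one_of_pos h]
    have hu2 : (u.2 : ℤ) = z.2 + ((z'.2 : ℤ) - z.2).sign := by
      refine Int.toNat_of_nonneg ?_
      rcases lt_trichotomy ((z'.2 : ℤ) - z.2) 0 with h | h | h
      · rw [Int.sign_eq_neg_one_of_neg h]; omega
      · simp [h]
      · rw [Int.sign_eq_one_of_pos h]; omega
    obtain ⟨n, hn, hpath⟩ := hunit z u (by
      refine ⟨⟨fun i => ?_, ?_⟩, ⟨fun i => ?_, ?_⟩⟩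
      · simpa [toZ, u] using (sign_mem (z'.1 i - z.1 i)).1
      · simpa [toZ, hu2] using (sign_mem ((z'.2 : ℤ) - z.2)).1
      · simpa [toZ, u] using (sign_mem (z'.1 i - z.1 i)).2
      · simpa [toZ, hu2] using (sign_mem ((z'.2 : ℤ) - z.2)).2)
    obtain ⟨m, hm, hpath'⟩ := ih u
      (fun i => by simpa only [u, sub_sub] using key _ (h₁ i))
      (by simpa only [hu2, sub_sub] using key _ h₂)
    refine ⟨n + m, ?_, hpath.trans hpath'⟩
    push_cast
    linarith

theorem natAbs_le_floor {t : ℤ} {x : ℝ} (h : ‖(t : ℝ)‖ ≤ x) : t.natAbs ≤ ⌊x⌋₊ := by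
  refine Nat.le_floor ?_
  rwa [Nat.cast_natAbs, Int.cast_abs]

end

/-- the reflected walk satisfies the communication condition on
`ℤ^{d-1}×ℕ`. -/
theorem communication_condition
    (d : ℕ) (hd : 2 ≤ d) (μ μ0 : Zd d → ℝ)
    (hμ : IsProb d μ) (hμ0 : IsProb d μ0)
    (hH0 : H0 d μ μ0) (hH1 : H1 d μ μ0) (hH2 : H2 d μ)
    (hH3 : H3 d μ μ0) :
    ∃ θ : ℝ, 0 < θ ∧ ∃ C : ℝ, 0 < C ∧
      ∀ z z' : St d, ∃ n : ℕ, ∃ w : ℕ → St d,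
        w 0 = z ∧ w n = z' ∧ (n : ℝ) ≤ C * ‖toR d (toZ d z' - toZ d z)‖ ∧
        ∀ i < n, ‖toR d (toZ d (w (i+1)) - toZ d (w i))‖ ≤ C ∧
          θ ≤ stepR d μ μ0 (w i) (w (i+1)) := by
  obtain ⟨C, hC, hunit⟩ := exists_hasPath_of_unit hH1 hH2
  refine ⟨C⁻¹, inv_pos.2 hC, C, hC, fun z z' => ?_⟩
  set v := toZ d z' - toZ d z with hv
  obtain ⟨n, hn, w, hw0, hwn, hw⟩ := exists_hasPath_of_natAbs_le hunit ⌊‖toR d v‖⌋₊ z z'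
    (fun i => natAbs_le_floor ((norm_le_pi_norm (toR d v).1 i).trans (norm_fst_le _)))
    (natAbs_le_floor (norm_snd_le (toR d v)))
  refine ⟨n, w, hw0, hwn, hn.trans ?_, hw⟩
  gcongr
  exact Nat.floor_le (norm_nonneg _)

end ReflectedRW
end
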